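/- arXiv:1611.06116 — 4 statements merged into one kernel-verified Lean document; each statement's English description precedes it below -/
import Mathlib

section
/- Let n be a positive integer. Then the number of (x,y,z) ∈ ℤ³ with x²+y²+2z² = 16n+2, x ≡ 1 (mod 2), y ≡ 1 (mod 2), and z ≡ 2 (mod 4) is zero if and only if 16n+2 = 2M² for some positive integer M all of whose prime divisors are congruent to 1 modulo 4. Moreover, for every positive integer n the number of (x,y,z) ∈ ℤ³ with x²+y²+2z² = 16n+10 and the same congruence conditions x ≡ 1 (mod 2), y ≡ 1 (mod 2), z ≡ 2 (mod 4) is positive. -/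
/-- Every integer has a representative of absolute value at most `m / 2` modulo `m`. -/
lemma exists_two_mul_abs_add_mul_le (x : ℤ) {m : ℤ} (hm : 0 < m) :
    ∃ k : ℤ, |2 * (x + k * m)| ≤ m := by
  refine ⟨-((2 * x + m) / (2 * m)), ?_⟩
  have h1 := Int.emod_add_mul_ediv (2 * x + m) (2 * m)
  have h2 := Int.emod_nonneg (2 * x + m) (show 2 * m ≠ 0 by omega)
  have h3 := Int.emod_lt_of_pos (2 * x + m) (show 0 < 2 * m by omega)
  rw [abs_le]
  constructor <;> linarith

/-- Lagrange reduction: a positive definite binary form of determinant `D` properly represents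
some `a` with `3 * a ^ 2 ≤ 4 * D`. -/
lemma exists_binary_reduction {D : ℤ} (hD : 0 < D) (A B C : ℤ) (hA : 0 < A)
    (h : A * C - B ^ 2 = D) :
    ∃ p q r s : ℤ, p * s - q * r = 1 ∧
      0 < A * p ^ 2 + 2 * B * p * r + C * r ^ 2 ∧
      3 * (A * p ^ 2 + 2 * B * p * r + C * r ^ 2) ^ 2 ≤ 4 * D := by
  induction hn : A.toNat using Nat.strong_induction_on generalizing A B C with
  | _ n ih =>
  obtain ⟨k, hk⟩ := exists_two_mul_abs_add_mul_le B hA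
  have hsq : (2 * (B + k * A)) ^ 2 ≤ A ^ 2 := sq_le_sq' (by linarith [abs_le.1 hk])
    (abs_le.1 hk).2
  have hdet : A * (C + 2 * k * B + k ^ 2 * A) - (B + k * A) ^ 2 = D := by rw [← h]; ring
  rcases le_or_gt A (C + 2 * k * B + k ^ 2 * A) with hC | hC
  · refine ⟨1, 0, 0, 1, by ring, by simpa using hA, ?_⟩
    have := mul_le_mul_of_nonneg_left hC hA.le
    nlinarith
  · have hC0 : 0 < C + 2 * k * B + k ^ 2 * A := by
      refine pos_of_mul_pos_right (a := A) ?_ hA.le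
      nlinarith [sq_nonneg (B + k * A)]
    obtain ⟨p, q, r, s, h1, h2, h3⟩ := ih _ (by omega) (C + 2 * k * B + k ^ 2 * A) (B + k * A) A
      hC0 (by rw [← hdet]; ring) rfl
    have e : A * (r + k * p) ^ 2 + 2 * B * (r + k * p) * p + C * p ^ 2 =
        (C + 2 * k * B + k ^ 2 * A) * p ^ 2 + 2 * (B + k * A) * p * r + A * r ^ 2 := by ring
    refine ⟨r + k * p, -(s + k * q), p, -q, by linear_combination h1, ?_, ?_⟩ <;> rw [e] <;>
      assumption

/-- A positive definite integral ternary form of determinant one takes only values that are sums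
of three squares. -/
lemma ternary_unimodular_eq_sum_three_sq (a b c d e g : ℤ) (ha : 0 < a) (hA : 0 < a * b - g ^ 2)
    (hdet : a * b * c + 2 * d * e * g - a * d ^ 2 - b * e ^ 2 - c * g ^ 2 = 1) (x y z : ℤ) :
    ∃ u v w : ℤ, a * x ^ 2 + b * y ^ 2 + c * z ^ 2 + 2 * d * y * z + 2 * e * x * z + 2 * g * x * y
      = u ^ 2 + v ^ 2 + w ^ 2 := by
  induction hn : a.toNat using Nat.strong_induction_on generalizing a b c d e g x y z with
  | _ n ih =>
  obtain ⟨p, q, r, s, hps, hA1, hA1'⟩ := exists_binary_reduction ha (a * b - g ^ 2)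
    (a * d - e * g) (a * c - e ^ 2) hA (by linear_combination a * hdet)
  -- pass to the coordinates in which the adjoint binary form is reduced
  obtain ⟨b₁, hb₁⟩ : ∃ b₁, b₁ = b * p ^ 2 + c * r ^ 2 + 2 * d * p * r := ⟨_, rfl⟩
  obtain ⟨c₁, hc₁⟩ : ∃ c₁, c₁ = b * q ^ 2 + c * s ^ 2 + 2 * d * q * s := ⟨_, rfl⟩
  obtain ⟨d₁, hd₁⟩ : ∃ d₁, d₁ = b * p * q + c * r * s + d * (p * s + q * r) := ⟨_, rfl⟩
  obtain ⟨e₁, he₁⟩ : ∃ e₁, e₁ = g * q + e * s := ⟨_, rfl⟩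
  obtain ⟨g₁, hg₁⟩ : ∃ g₁, g₁ = g * p + e * r := ⟨_, rfl⟩
  have hAeq : (a * b - g ^ 2) * p ^ 2 + 2 * (a * d - e * g) * p * r + (a * c - e ^ 2) * r ^ 2 =
      a * b₁ - g₁ ^ 2 := by rw [hb₁, hg₁]; ring
  rw [hAeq] at hA1 hA1'
  have hdet₁ : a * b₁ * c₁ + 2 * d₁ * e₁ * g₁ - a * d₁ ^ 2 - b₁ * e₁ ^ 2 - c₁ * g₁ ^ 2 = 1 := by
    have : a * b₁ * c₁ + 2 * d₁ * e₁ * g₁ - a * d₁ ^ 2 - b₁ * e₁ ^ 2 - c₁ * g₁ ^ 2 =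
        (a * b * c + 2 * d * e * g - a * d ^ 2 - b * e ^ 2 - c * g ^ 2) * (p * s - q * r) ^ 2 := by
      rw [hb₁, hc₁, hd₁, he₁, hg₁]; ring
    rw [this, hdet, hps]; norm_num
  obtain ⟨Y, hY⟩ : ∃ Y, Y = s * y - q * z := ⟨_, rfl⟩
  obtain ⟨Z, hZ⟩ : ∃ Z, Z = p * z - r * y := ⟨_, rfl⟩
  have hy : y = p * Y + q * Z := by rw [hY, hZ]; linear_combination -y * hps
  have hz : z = r * Y + s * Z := by rw [hY, hZ]; linear_combination -z * hps
  have hf : a * x ^ 2 + b * y ^ 2 + c * z ^ 2 + 2 * d * y * z + 2 * e * x * z + 2 * g * x * y =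
      a * x ^ 2 + b₁ * Y ^ 2 + c₁ * Z ^ 2 + 2 * d₁ * Y * Z + 2 * e₁ * x * Z + 2 * g₁ * x * Y := by
    rw [hy, hz, hb₁, hc₁, hd₁, he₁, hg₁]; ring
  rw [hf]
  clear hf hy hz hY hZ hAeq hb₁ hc₁ hd₁ he₁ hg₁ hps hdet hA
  obtain ⟨k, hk⟩ := exists_two_mul_abs_add_mul_le g₁ ha
  have hsq : (2 * (g₁ + k * a)) ^ 2 ≤ a ^ 2 := sq_le_sq' (by linarith [abs_le.1 hk])
    (abs_le.1 hk).2
  have hA2 : a * (b₁ + 2 * k * g₁ + k ^ 2 * a) - (g₁ + k * a) ^ 2 = a * b₁ - g₁ ^ 2 := by ring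
  rcases le_or_gt a (b₁ + 2 * k * g₁ + k ^ 2 * a) with hb | hb
  · have h1 : 3 * a ^ 2 ≤ 4 * (a * b₁ - g₁ ^ 2) := by
      have := mul_le_mul_of_nonneg_left hb ha.le
      nlinarith
    have h2 : a = 1 := by
      by_contra hne
      have h4 : (3 * a ^ 2) ^ 2 ≤ (4 * (a * b₁ - g₁ ^ 2)) ^ 2 :=
        pow_le_pow_left₀ (by positivity) h1 2
      have h5 : a * (27 * a ^ 3) ≤ a * 64 := by nlinarith
      have h6 := le_of_mul_le_mul_left h5 ha
      have h7 : 2 ≤ a := by omega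
      have h8 : 2 ^ 3 ≤ a ^ 3 := pow_le_pow_left₀ (by norm_num) h7 3
      omega
    subst h2
    have h3 : 1 * b₁ - g₁ ^ 2 = 1 := by nlinarith
    refine ⟨x + g₁ * Y + e₁ * Z, Y + (d₁ - e₁ * g₁) * Z, Z, ?_⟩
    have hb1 : b₁ = 1 + g₁ ^ 2 := by linarith
    subst hb1
    linear_combination Z ^ 2 * hdet₁
  · have hb0 : 0 < b₁ + 2 * k * g₁ + k ^ 2 * a := by
      refine pos_of_mul_pos_right (a := a) ?_ ha.le
      nlinarith [sq_nonneg (g₁ + k * a)]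
    obtain ⟨u, v, w, h⟩ := ih _ (by omega) (b₁ + 2 * k * g₁ + k ^ 2 * a) a c₁ e₁ (d₁ + k * e₁)
      (g₁ + k * a) hb0 (by linarith) (by linear_combination hdet₁) Y (x - k * Y) Z rfl
    exact ⟨u, v, w, by rw [← h]; ring⟩

open NumberTheorySymbols in
lemma jacobiSym_neg_eq_one {N p b : ℕ} (hb : b % 8 = 3) (hp : p % 2 = 1)
    (h : 2 * p + 1 = b * N) : J(-(b : ℤ) | p) = 1 := by
  have hbo : Odd b := Nat.odd_iff.2 (by omega)
  have hpo : Odd p := Nat.odd_iff.2 hp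
  have h1 : J(-(b : ℤ) | p) = J((p : ℤ) | b) := by
    rw [neg_eq_neg_one_mul, jacobiSym.mul_left, jacobiSym.at_neg_one hpo]
    rcases (show p % 4 = 1 ∨ p % 4 = 3 by omega) with h4 | h4
    · rw [ZMod.χ₄_nat_one_mod_four h4, one_mul,
        jacobiSym.quadratic_reciprocity_one_mod_four' hbo h4]
    · rw [ZMod.χ₄_nat_three_mod_four h4,
        jacobiSym.quadratic_reciprocity_three_mod_four (by omega) h4]
      ring
  have h2 : J(-2 | b) = 1 := by
    rw [jacobiSym.at_neg_two hbo, ZMod.χ₈'_nat_eq_if_mod_eight]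
    simp [hb, show b % 2 ≠ 0 by omega]
  have h3 : J(-2 * (p : ℤ) | b) = 1 := by
    rw [jacobiSym.mod_left' (a₂ := 1), jacobiSym.one_left]
    refine Int.modEq_iff_dvd.2 ⟨N, ?_⟩
    linear_combination (by exact_mod_cast h : (2 * p + 1 : ℤ) = b * N)
  rw [jacobiSym.mul_left, h2, one_mul] at h3
  rw [h1, h3]

/-- Every integer greater than one and congruent to one modulo four is a sum of three squares. -/
lemma eq_sum_three_sq_of_mod_four_eq_one {N : ℕ} (h1 : 1 < N) (hN : N % 4 = 1) :
    ∃ x y z : ℤ, (N : ℤ) = x ^ 2 + y ^ 2 + z ^ 2 := by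
  obtain ⟨k, rfl⟩ : ∃ k, N = 4 * k + 1 := ⟨N / 4, by omega⟩
  have hcop : IsCoprime ((6 * k + 1 : ℕ) : ℤ) ((4 * (4 * k + 1) : ℕ) : ℤ) := by
    push_cast
    have h2 : IsCoprime (6 * k + 1 : ℤ) 2 := ⟨1, -(3 * k), by ring⟩
    have h3 : IsCoprime (6 * k + 1 : ℤ) (4 * k + 1) := ⟨-2, 3, by ring⟩
    exact (show (4 : ℤ) = 2 * 2 by norm_num) ▸ (h2.mul_right h2).mul_right h3
  obtain ⟨p, hpgt, hp, hmod⟩ := Nat.forall_exists_prime_gt_and_zmodEq (6 * k + 1)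
    (by omega) hcop
  rw [Int.natCast_modEq_iff] at hmod
  obtain ⟨v, hv⟩ := (Nat.modEq_iff_dvd' hpgt.le).1 hmod.symm
  have hpv : p = 4 * (4 * k + 1) * v + (6 * k + 1) := by omega
  have hbN : 2 * p + 1 = (8 * v + 3) * (4 * k + 1) := by rw [hpv]; ring
  have hpodd : p % 2 = 1 := by
    rw [hpv, mul_assoc]; omega
  have : Fact p.Prime := ⟨hp⟩
  obtain ⟨s₀, hs₀⟩ := ZMod.isSquare_of_jacobiSym_eq_one
    (jacobiSym_neg_eq_one (by omega) hpodd hbN)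
  obtain ⟨s, hs⟩ : ∃ s : ℤ, (2 * p : ℤ) ∣ s ^ 2 + (8 * v + 3 : ℕ) := by
    have h0 : (p : ℤ) ∣ (s₀.val : ℤ) ^ 2 + (8 * v + 3 : ℕ) := by
      rw [← ZMod.intCast_zmod_eq_zero_iff_dvd]
      push_cast at hs₀ ⊢
      rw [ZMod.natCast_val, ZMod.cast_id]
      linear_combination -hs₀
    have hc : IsCoprime (2 : ℤ) p := by
      rw [← Nat.cast_ofNat, Nat.isCoprime_iff_coprime]
      exact (Nat.coprime_two_left).2 (Nat.odd_iff.2 hpodd)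
    rcases Int.even_or_odd (s₀.val : ℤ) with he | he
    · refine ⟨s₀.val + p, hc.mul_dvd ?_ ?_⟩
      · have : Odd ((s₀.val : ℤ) + p) := he.add_odd (by exact_mod_cast Nat.odd_iff.2 hpodd)
        refine ((this.pow).add_odd ?_).two_dvd
        exact_mod_cast Nat.odd_iff.2 (by omega)
      · have := h0.add (Dvd.intro ((2 * s₀.val + p : ℤ)) rfl)
        refine this.trans (dvd_of_eq (by ring))
    · refine ⟨s₀.val, hc.mul_dvd ?_ h0⟩
      refine ((he.pow).add_odd ?_).two_dvd
      exact_mod_cast Nat.odd_iff.2 (by omega)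
  obtain ⟨a, ha⟩ := hs
  have hp0 : (0 : ℤ) < 2 * p := by exact_mod_cast Nat.mul_pos two_pos hp.pos
  have hbN' : (2 * p + 1 : ℤ) = (8 * v + 3) * (4 * k + 1) := by exact_mod_cast hbN
  push_cast at ha
  have ha0 : 0 < a := by
    refine pos_of_mul_pos_right (a := (2 * p : ℤ)) ?_ hp0.le
    rw [← ha]; positivity
  obtain ⟨u, w, t, h⟩ := ternary_unimodular_eq_sum_three_sq a (2 * p) (4 * k + 1) 0 1 s ha0
    (by nlinarith) (by linear_combination -hbN' - (4 * k + 1) * ha) 0 0 1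
  exact ⟨u, w, t, by rw [← h]; push_cast; ring⟩

open Quaternion in
lemma Quaternion.exists_coords (a b c d : ℤ) :
    ∃ α : ℍ[ℤ], α.re = a ∧ α.imI = b ∧ α.imJ = c ∧ α.imK = d :=
  ⟨⟨a, b, c, d⟩, rfl, rfl, rfl, rfl⟩

open Quaternion in
/-- A Lipschitz quaternion of even norm is left divisible, up to association, by a quaternion of
norm two. -/
lemma exists_normSq_eq_two_mul_eq_two_smul (α : ℍ[ℤ]) (h : 2 ∣ normSq α) :
    ∃ β γ : ℍ[ℤ], normSq β = 2 ∧ β * α = (2 : ℤ) • γ := by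
  obtain ⟨x, hx⟩ : ∃ x, x = α.re := ⟨_, rfl⟩
  obtain ⟨y, hy⟩ : ∃ y, y = α.imI := ⟨_, rfl⟩
  obtain ⟨z, hz⟩ : ∃ z, z = α.imJ := ⟨_, rfl⟩
  obtain ⟨w, hw⟩ : ∃ w, w = α.imK := ⟨_, rfl⟩
  rw [normSq_def', ← hx, ← hy, ← hz, ← hw] at h
  have hpar : (x + y + z + w) % 2 = 0 := by
    clear hx hy hz hw
    rcases Int.emod_two_eq_zero_or_one x with hx | hx <;>
    rcases Int.emod_two_eq_zero_or_one y with hy | hy <;>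
    rcases Int.emod_two_eq_zero_or_one z with hz | hz <;>
    rcases Int.emod_two_eq_zero_or_one w with hw | hw <;>
    simp [Int.dvd_iff_emod_eq_zero, Int.add_emod, pow_two, Int.mul_emod, hx, hy, hz, hw] at h ⊢
  have key : ∀ a b c d : ℤ, (a + b) % 2 = 0 → (c + d) % 2 = 0 →
      a - b = 2 * ((a - b) / 2) ∧ a + b = 2 * ((a + b) / 2) ∧
      c - d = 2 * ((c - d) / 2) ∧ c + d = 2 * ((c + d) / 2) := by omega
  rcases (show (x + y) % 2 = 0 ∧ (z + w) % 2 = 0 ∨ (x + z) % 2 = 0 ∧ (w + y) % 2 = 0 ∨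
    (x + w) % 2 = 0 ∧ (y + z) % 2 = 0 by omega) with ⟨h1, h2⟩ | ⟨h1, h2⟩ | ⟨h1, h2⟩
  · obtain ⟨k1, k2, k3, k4⟩ := key _ _ _ _ h1 h2
    obtain ⟨β, a1, a2, a3, a4⟩ := Quaternion.exists_coords 1 1 0 0
    obtain ⟨γ, b1, b2, b3, b4⟩ := Quaternion.exists_coords ((x - y) / 2) ((x + y) / 2) ((z - w) / 2) ((z + w) / 2)
    refine ⟨β, γ, by rw [normSq_def', a1, a2, a3, a4]; norm_num, ?_⟩
    ext <;> simp [-zsmul_eq_mul, a1, a2, a3, a4, b1, b2, b3, b4, ← hx, ← hy, ← hz, ← hw] <;> linarith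
  · obtain ⟨k1, k2, k3, k4⟩ := key _ _ _ _ h1 h2
    obtain ⟨β, a1, a2, a3, a4⟩ := Quaternion.exists_coords 1 0 1 0
    obtain ⟨γ, b1, b2, b3, b4⟩ := Quaternion.exists_coords ((x - z) / 2) ((w + y) / 2) ((x + z) / 2) ((w - y) / 2)
    refine ⟨β, γ, by rw [normSq_def', a1, a2, a3, a4]; norm_num, ?_⟩
    ext <;> simp [-zsmul_eq_mul, a1, a2, a3, a4, b1, b2, b3, b4, ← hx, ← hy, ← hz, ← hw] <;> linarith
  · obtain ⟨k1, k2, k3, k4⟩ := key _ _ _ _ h1 h2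
    obtain ⟨β, a1, a2, a3, a4⟩ := Quaternion.exists_coords 1 0 0 1
    obtain ⟨γ, b1, b2, b3, b4⟩ := Quaternion.exists_coords ((x - w) / 2) ((y - z) / 2) ((y + z) / 2) ((x + w) / 2)
    refine ⟨β, γ, by rw [normSq_def', a1, a2, a3, a4]; norm_num, ?_⟩
    ext <;> simp [-zsmul_eq_mul, a1, a2, a3, a4, b1, b2, b3, b4, ← hx, ← hy, ← hz, ← hw] <;> linarith

open Quaternion in
/-- Lagrange's descent inside a left ideal of Lipschitz quaternions. -/
lemma exists_normSq_eq_prime {q : ℤ} (hq : Prime q) (P : ℍ[ℤ] → Prop)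
    (hmul : ∀ β α, P α → P (β * α))
    (hdiv : ∀ (m : ℤ) α, 0 < m → m < q → P (m • α) → P α)
    (m : ℤ) (hm : 0 < m) (hmq : m < q) (α : ℍ[ℤ]) (hα : P α) (hN : normSq α = m * q) :
    ∃ β, P β ∧ normSq β = q := by
  induction hn : m.toNat using Nat.strong_induction_on generalizing m α with
  | _ n ih =>
  rcases eq_or_lt_of_le (show 1 ≤ m by omega) with rfl | hm1
  · exact ⟨α, hα, by rw [hN, one_mul]⟩
  have hcop : IsCoprime m q := by
    refine ((hq.coprime_iff_not_dvd).2 fun h ↦ ?_).symm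
    exact absurd (Int.le_of_dvd hm h) (by omega)
  rcases Int.even_or_odd' m with ⟨l, rfl | rfl⟩
  · obtain ⟨β, γ, hβ, hγ⟩ := exists_normSq_eq_two_mul_eq_two_smul α
      (by rw [hN, mul_assoc]; exact dvd_mul_right _ _)
    have h1 := congrArg normSq hγ
    rw [map_mul, normSq_smul, hβ, hN] at h1
    exact ih _ (by omega) l (by omega) (by omega) γ
      (hdiv 2 γ (by omega) (by omega) (hγ ▸ hmul β α hα)) (by linarith) rfl
  · obtain ⟨m, hm'⟩ : ∃ m, m = 2 * l + 1 := ⟨_, rfl⟩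
    rw [← hm'] at hm hmq hN hn hm1 hcop
    obtain ⟨k1, h1⟩ := exists_two_mul_abs_add_mul_le α.re hm
    obtain ⟨k2, h2⟩ := exists_two_mul_abs_add_mul_le α.imI hm
    obtain ⟨k3, h3⟩ := exists_two_mul_abs_add_mul_le α.imJ hm
    obtain ⟨k4, h4⟩ := exists_two_mul_abs_add_mul_le α.imK hm
    obtain ⟨κ, e1, e2, e3, e4⟩ := Quaternion.exists_coords k1 k2 k3 k4
    obtain ⟨ρ, hρ⟩ : ∃ ρ : ℍ[ℤ], ρ = α + m • κ := ⟨_, rfl⟩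
    have hlt : normSq ρ < m * m := by
      have key : ∀ x k : ℤ, |2 * (x + k * m)| ≤ m → (2 * (x + m * k)) ^ 2 < m ^ 2 := by
        intro x k h
        rw [abs_le] at h
        rw [mul_comm m k]
        generalize k * m = s at h
        exact sq_lt_sq' (by omega) (by omega)
      rw [normSq_def', hρ]
      have := key _ _ h1
      have := key _ _ h2
      have := key _ _ h3
      have := key _ _ h4
      simp [e1, e2, e3, e4]
      linarith
    have hγ : star ρ * α = m • ((q : ℍ[ℤ]) + star κ * α) := by
      rw [hρ, star_add, Quaternion.star_smul, add_mul, star_mul_self, hN, smul_mul_assoc, smul_add]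
      congr 1
      ext <;> simp
    have e := congrArg normSq hγ
    rw [map_mul, normSq_smul, normSq_star, hN] at e
    have e' : normSq ρ * q = m * normSq ((q : ℍ[ℤ]) + star κ * α) :=
      mul_left_cancel₀ hm.ne' (by linear_combination e)
    obtain ⟨m', hm''⟩ : m ∣ normSq ρ := hcop.dvd_of_dvd_mul_right (Dvd.intro _ e'.symm)
    have hm'lt : m' < m := by
      rw [hm''] at hlt
      exact lt_of_mul_lt_mul_left hlt hm.le
    have hm'pos : 0 < m' := by
      refine pos_of_mul_pos_right (a := m) (hm'' ▸ normSq_nonneg.lt_of_ne' fun h0 ↦ ?_) hm.le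
      rw [normSq_eq_zero, hρ, add_eq_zero_iff_eq_neg] at h0
      have := congrArg normSq h0
      rw [normSq_neg, normSq_smul, hN] at this
      have hd : m ∣ q := ⟨normSq κ, mul_left_cancel₀ hm.ne' (by linear_combination this)⟩
      have := hcop.isUnit_of_dvd' dvd_rfl hd
      rw [Int.isUnit_iff] at this
      omega
    refine ih _ (by omega) m' hm'pos (by omega) ((q : ℍ[ℤ]) + star κ * α)
      (hdiv m _ hm hmq (hγ ▸ hmul _ _ hα)) ?_ rfl
    refine mul_left_cancel₀ hm.ne' ?_
    rw [← e', hm'']; ring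

open Quaternion in
/-- If `-a ^ 2 - b ^ 2 - c ^ 2` is a nonzero square modulo a prime `q`, then some quaternion of
norm `q` conjugates the pure quaternion `(a, b, c)` into an integral one. -/
lemma exists_integral_conj_of_prime {q t : ℤ} (v : ℍ[ℤ]) (hv : v.re = 0) (hq : Prime q)
    (hq0 : 0 < q) (hqodd : q % 2 = 1) (ht : q ∣ t ^ 2 + normSq v) (hqt : ¬ q ∣ t) :
    ∃ α u : ℍ[ℤ], normSq α = q ∧ α * v * star α = q • u := by
  obtain ⟨n, hn⟩ := ht
  have hn' := hn
  rw [normSq_def', hv] at hn'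
  obtain ⟨k1, h1⟩ := exists_two_mul_abs_add_mul_le t hq0
  obtain ⟨k2, h2⟩ := exists_two_mul_abs_add_mul_le v.imI hq0
  obtain ⟨k3, h3⟩ := exists_two_mul_abs_add_mul_le v.imJ hq0
  obtain ⟨k4, h4⟩ := exists_two_mul_abs_add_mul_le v.imK hq0
  obtain ⟨κ, e1, e2, e3, e4⟩ := Quaternion.exists_coords k1 k2 k3 k4
  obtain ⟨α, f1, f2, f3, f4⟩ := Quaternion.exists_coords (t + k1 * q) (v.imI + k2 * q)
    (v.imJ + k3 * q) (v.imK + k4 * q)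
  have hlt : normSq α < q * q := by
    have key : ∀ x : ℤ, |2 * x| ≤ q → (2 * x) ^ 2 < q ^ 2 := by
      intro x h
      rw [abs_le] at h
      exact sq_lt_sq' (by omega) (by omega)
    rw [normSq_def', f1, f2, f3, f4]
    have := key _ h1
    have := key _ h2
    have := key _ h3
    have := key _ h4
    linarith
  obtain ⟨m, hm⟩ : ∃ m, normSq α = m * q := by
    refine ⟨n + 2 * (t * k1 + v.imI * k2 + v.imJ * k3 + v.imK * k4) +
      q * (k1 ^ 2 + k2 ^ 2 + k3 ^ 2 + k4 ^ 2), ?_⟩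
    rw [normSq_def', f1, f2, f3, f4]
    linear_combination hn'
  have hmq : m < q := by
    rw [hm] at hlt
    exact lt_of_mul_lt_mul_right hlt hq0.le
  have hm0 : 0 < m := by
    refine pos_of_mul_pos_left (b := q) (hm ▸ normSq_nonneg.lt_of_ne' fun h0 ↦ hqt ?_) hq0.le
    rw [normSq_eq_zero] at h0
    rw [h0] at f1
    exact ⟨-k1, by simp at f1; linarith⟩
  have hP : ∃ c : ℍ[ℤ], α * v - t • α = q • c := by
    refine ⟨κ * v - t • κ - (n : ℍ[ℤ]), ?_⟩
    ext <;> simp [-zsmul_eq_mul, e1, e2, e3, e4, f1, f2, f3, f4, hv]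
    · linear_combination -hn'
    all_goals ring
  obtain ⟨β, ⟨c, hc⟩, hβ⟩ := exists_normSq_eq_prime hq
    (fun α ↦ ∃ c : ℍ[ℤ], α * v - t • α = q • c)
    (fun β α ⟨c, hc⟩ ↦ ⟨β * c, by
      rw [mul_assoc, ← mul_smul_comm, ← mul_sub, hc, mul_smul_comm]⟩)
    (fun m α hm hmq ⟨c, hc⟩ ↦ by
      have hcop : IsCoprime q m := (hq.coprime_iff_not_dvd).2 fun h ↦
        absurd (Int.le_of_dvd hm h) (by omega)
      obtain ⟨x, y, hxy⟩ := hcop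
      refine ⟨x • (α * v - t • α) + y • c, ?_⟩
      have hc' : m • (α * v - t • α) = q • c := by
        rw [← hc, smul_sub, smul_mul_assoc, smul_comm t m α]
      calc α * v - t • α = (x * q + y * m) • (α * v - t • α) := by rw [hxy, one_smul]
        _ = q • (x • (α * v - t • α) + y • c) := by
          rw [add_smul, mul_smul y, hc', smul_add, mul_comm x, mul_smul, smul_comm y])
    m hm0 hmq α hP hm
  refine ⟨β, (t : ℍ[ℤ]) + c * star β, hβ, ?_⟩
  rw [sub_eq_iff_eq_add.1 hc, add_mul, smul_mul_assoc, smul_mul_assoc, self_mul_star, hβ,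
    smul_add, add_comm]
  congr 1
  ext <;> simp [-zsmul_eq_mul, mul_comm]

open Quaternion in
/-- Conjugation by a quaternion of norm `q ≡ 3 [ZMOD 4]` moves representations as a sum of three
squares from one residue class modulo four to another. -/
lemma exists_sum_three_sq_two_mod_four {a b c q t : ℤ} (ha : a % 2 = 1) (hb : b % 4 = 0)
    (hc : c % 4 = 0) (hq : Prime q) (hq0 : 0 < q) (hq4 : q % 4 = 3)
    (ht : q ∣ t ^ 2 + (a ^ 2 + b ^ 2 + c ^ 2)) (hqt : ¬ q ∣ t) :
    ∃ x y z : ℤ, a ^ 2 + b ^ 2 + c ^ 2 = x ^ 2 + y ^ 2 + z ^ 2 ∧ y % 4 = 2 ∧ z % 4 = 2 := by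
  obtain ⟨v, v1, v2, v3, v4⟩ := Quaternion.exists_coords 0 a b c
  have hN : normSq v = a ^ 2 + b ^ 2 + c ^ 2 := by
    rw [normSq_def', v1, v2, v3, v4]; ring
  obtain ⟨α, u, hα, hu⟩ := exists_integral_conj_of_prime v v1 hq hq0 (by omega) (hN ▸ ht) hqt
  have hnorm : normSq v = normSq u := by
    have := congrArg normSq hu
    rw [map_mul, map_mul, normSq_star, normSq_smul, hα] at this
    exact mul_left_cancel₀ (pow_ne_zero 2 hq0.ne') (by linear_combination this)
  have hre := congrArg QuaternionAlgebra.re hu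
  have hJ := congrArg QuaternionAlgebra.imJ hu
  have hK := congrArg QuaternionAlgebra.imK hu
  simp [-zsmul_eq_mul, v1, v2, v3, v4] at hre hJ hK
  have hre0 : u.re = 0 := by
    refine (mul_eq_zero.1 (?_ : q * u.re = 0)).resolve_left hq0.ne'
    rw [← hre]; ring
  rw [normSq_def'] at hα
  generalize α.re = x at *
  generalize α.imI = y at *
  generalize α.imJ = z at *
  generalize α.imK = w at *
  have hpar : (y * z + x * w) % 2 = 1 ∧ (y * w - x * z) % 2 = 1 := by
    have h4 := congrArg (· % 4) hα
    simp only [hq4] at h4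
    rcases Int.even_or_odd' x with ⟨x', rfl | rfl⟩ <;>
    rcases Int.even_or_odd' y with ⟨y', rfl | rfl⟩ <;>
    rcases Int.even_or_odd' z with ⟨z', rfl | rfl⟩ <;>
    rcases Int.even_or_odd' w with ⟨w', rfl | rfl⟩ <;>
    ring_nf at h4 ⊢ <;> omega
  have key : ∀ r S T : ℤ, S % 2 = 1 → q * r = 2 * (S * a) + 4 * T → r % 4 = 2 := by
    intro r S T hS h
    have h1 : (S * a) % 2 = 1 := by rw [Int.mul_emod, hS, ha]; rfl
    have h2 : (q * r) % 4 = 2 := by omega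
    rw [Int.mul_emod, hq4] at h2
    omega
  obtain ⟨b', rfl⟩ : ∃ b', b = 4 * b' := ⟨b / 4, by omega⟩
  obtain ⟨c', rfl⟩ : ∃ c', c = 4 * c' := ⟨c / 4, by omega⟩
  refine ⟨u.imI, u.imJ, u.imK, ?_, key _ _
    ((x ^ 2 - y ^ 2 + z ^ 2 - w ^ 2) * b' + 2 * (z * w - x * y) * c') hpar.1 ?_, key _ _
    ((x ^ 2 - y ^ 2 - z ^ 2 + w ^ 2) * c' + 2 * (z * w + x * y) * b') hpar.2 ?_⟩
  · rw [← hN, hnorm, normSq_def', hre0]; ring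
  · rw [← hJ]; ring
  · rw [← hK]; ring

open NumberTheorySymbols in
lemma exists_jacobiSym_eq_neg_one {N : ℕ} (hN : N % 2 = 1) (hsq : ¬ IsSquare N) :
    ∃ r : ℕ, J((r : ℤ) | N) = -1 := by
  obtain ⟨a, b, hab, ha⟩ := Nat.sq_mul_squarefree N
  have ha1 : a ≠ 1 := by
    rintro rfl
    exact hsq ⟨b, by rw [← hab]; ring⟩
  obtain ⟨p, hp, a', rfl⟩ := Nat.exists_prime_and_dvd ha1
  have : Fact p.Prime := ⟨hp⟩
  have hpa : ¬ p ∣ a' := fun h ↦ hp.one_lt.ne' (Nat.isUnit_iff.1 (ha p (mul_dvd_mul_left p h)))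
  have hb0 : b ≠ 0 := by rintro rfl; simp at hab; omega
  have ha0 : a' ≠ 0 := by rintro rfl; simp at hpa
  have hp2 : p ≠ 2 := by
    rintro rfl
    have : 2 ∣ N := hab ▸ (dvd_mul_right 2 a').mul_left _
    omega
  obtain ⟨k, b', hpb, rfl⟩ := Nat.exists_eq_pow_mul_and_not_dvd hb0 p hp.ne_one
  obtain ⟨s, hs⟩ := FiniteField.exists_nonsquare (F := ZMod p) (by rwa [ZMod.ringChar_zmod_n])
  have hcop : p.Coprime (a' * b') :=
    (hp.coprime_iff_not_dvd.2 hpa).mul_right (hp.coprime_iff_not_dvd.2 hpb)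
  obtain ⟨r, hr1, hr2⟩ := Nat.chineseRemainder hcop s.val 1
  have hrp : J((r : ℤ) | p) = -1 := by
    rw [ZMod.nonsquare_iff_jacobiSym_eq_neg_one]
    have := (ZMod.natCast_eq_natCast_iff _ _ _).2 hr1
    rw [Int.cast_natCast, this, ZMod.natCast_val, ZMod.cast_id]
    exact hs
  have hra : J((r : ℤ) | a') = 1 := by
    rw [jacobiSym.mod_left' (a₂ := 1), jacobiSym.one_left]
    exact_mod_cast hr2.of_mul_right b'
  have hrb : r.Coprime (p ^ k * b') := by
    refine Nat.Coprime.mul_right (Nat.Coprime.pow_right k ?_) ?_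
    · refine (hp.coprime_iff_not_dvd.2 fun h ↦ ?_).symm
      rw [(jacobiSym.eq_zero_iff).2] at hrp
      · norm_num at hrp
      · refine ⟨hp.ne_zero, ?_⟩
        rw [Int.gcd_natCast_natCast, Nat.gcd_eq_right h]
        exact hp.ne_one
    · have := (hr2.of_mul_left a').gcd_eq
      rwa [Nat.gcd_one_left] at this
  refine ⟨r, ?_⟩
  rw [← hab, jacobiSym.mul_right' _ (pow_ne_zero 2 hb0) (mul_ne_zero hp.ne_zero ha0),
    jacobiSym.mul_right' _ hp.ne_zero ha0, hrp, hra, jacobiSym.pow_right, jacobiSym.sq_one]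
  · norm_num
  · rwa [Int.gcd_natCast_natCast]

open NumberTheorySymbols in
/-- If `N ≡ 1 [MOD 4]` is not a square, then `-N` is a nonzero square modulo some prime
congruent to three modulo four. -/
lemma exists_prime_mod_four_eq_three_dvd_sq_add {N : ℕ} (hN : N % 4 = 1) (hsq : ¬ IsSquare N) :
    ∃ q t : ℤ, Prime q ∧ 0 < q ∧ q % 4 = 3 ∧ q ∣ t ^ 2 + N ∧ ¬ q ∣ t := by
  obtain ⟨r, hr⟩ := exists_jacobiSym_eq_neg_one (by omega) hsq
  have hrN : r.Coprime N := by
    by_contra h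
    rw [(jacobiSym.eq_zero_iff).2 ⟨by omega, by rwa [Int.gcd_natCast_natCast]⟩] at hr
    norm_num at hr
  have hcop : Nat.Coprime 4 N := by
    have : Nat.Coprime 2 N := (Nat.coprime_two_left).2 (Nat.odd_iff.2 (by omega))
    exact Nat.Coprime.mul_left this this
  obtain ⟨s, hs1, hs2⟩ := Nat.chineseRemainder hcop 3 r
  have hsN : s.Coprime (4 * N) := by
    refine Nat.Coprime.mul_right ?_ ?_
    · have := hs1.gcd_eq
      simpa [Nat.Coprime] using this
    · have := hs2.gcd_eq
      rwa [hrN] at this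
  obtain ⟨q, -, hq, hmod⟩ := Nat.forall_exists_prime_gt_and_zmodEq 0 (q := 4 * N) (a := s)
    (by omega) (Nat.isCoprime_iff_coprime.2 hsN)
  rw [Int.natCast_modEq_iff] at hmod
  have hq4 : q % 4 = 3 := (hmod.of_mul_right N).trans hs1
  have hqr : q ≡ r [MOD N] := (hmod.of_mul_left 4).trans hs2
  have : Fact q.Prime := ⟨hq⟩
  have hJ : J((N : ℤ) | q) = -1 := by
    rw [jacobiSym.quadratic_reciprocity_one_mod_four hN (Nat.odd_iff.2 (by omega)), ← hr]
    exact jacobiSym.mod_left' (by exact_mod_cast hqr)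
  have hJ' : J(-(N : ℤ) | q) = 1 := by
    rw [neg_eq_neg_one_mul, jacobiSym.mul_left, jacobiSym.at_neg_one (Nat.odd_iff.2 (by omega)),
      ZMod.χ₄_nat_three_mod_four hq4, hJ]
    norm_num
  obtain ⟨t, ht⟩ := ZMod.isSquare_of_jacobiSym_eq_one hJ'
  have hdvd : (q : ℤ) ∣ (t.val : ℤ) ^ 2 + N := by
    rw [← ZMod.intCast_zmod_eq_zero_iff_dvd]
    push_cast at ht ⊢
    rw [ZMod.natCast_val, ZMod.cast_id]
    linear_combination -ht
  refine ⟨q, t.val, Nat.prime_iff_prime_int.1 hq, by exact_mod_cast hq.pos, by omega, hdvd,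
    fun h ↦ ?_⟩
  have hqN : (q : ℤ) ∣ N := (dvd_add_right (dvd_pow h two_ne_zero)).1 hdvd
  rw [jacobiSym.eq_zero_iff.2] at hJ
  · norm_num at hJ
  · refine ⟨hq.ne_zero, ?_⟩
    rw [Int.gcd_natCast_natCast, Nat.gcd_eq_right (Int.natCast_dvd_natCast.1 hqN)]
    exact hq.ne_one

lemma Nat.mod_four_eq_one_of_forall_prime {M : ℕ} (hM : 0 < M)
    (h : ∀ p : ℕ, p.Prime → p ∣ M → p % 4 = 1) : M % 4 = 1 := by
  induction M using Nat.recOnMul with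
  | zero => omega
  | one => rfl
  | prime p hp => exact h p hp dvd_rfl
  | mul a b iha ihb =>
    have ha := iha (Nat.pos_of_mul_pos_right hM) fun p hp hd ↦ h p hp (hd.mul_right b)
    have hb := ihb (Nat.pos_of_mul_pos_left hM) fun p hp hd ↦ h p hp (hd.mul_left a)
    rw [Nat.mul_mod, ha, hb]

/-- If no prime congruent to three modulo four divides `u + v`, and `u * v` is a sum of two
squares, then so is `u`. -/
lemma Nat.eq_sq_add_sq_of_mul_of_add {u v : ℕ} (hu : u ≠ 0) (hv : v ≠ 0)
    (h : ∀ p : ℕ, p.Prime → p ∣ u + v → p % 4 = 1) (huv : ∃ x y, u * v = x ^ 2 + y ^ 2) :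
    ∃ x y, u = x ^ 2 + y ^ 2 := by
  rw [Nat.eq_sq_add_sq_iff] at huv ⊢
  intro q hq hq4
  have hp := Nat.prime_of_mem_primeFactors hq
  have hqu := Nat.dvd_of_mem_primeFactors hq
  have : Fact q.Prime := ⟨hp⟩
  have hqv : ¬ q ∣ v := fun hqv ↦ by
    have := h q hp (dvd_add hqu hqv)
    omega
  have := huv q (Nat.mem_primeFactors.2 ⟨hp, hqu.mul_right v, mul_ne_zero hu hv⟩) hq4
  rwa [padicValNat.mul hu hv, padicValNat.eq_zero_of_not_dvd hqv, add_zero] at this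

lemma sq_ne_add_of_forall_prime {M : ℕ} (hM : 0 < M)
    (h : ∀ p : ℕ, p.Prime → p ∣ M → p % 4 = 1) {a b c : ℤ} (hb : b % 4 = 2) (hc : c % 4 = 2) :
    (M : ℤ) ^ 2 ≠ a ^ 2 + b ^ 2 + c ^ 2 := by
  intro he
  have hM4 := Nat.mod_four_eq_one_of_forall_prime hM h
  obtain ⟨b, rfl⟩ : ∃ b', b = 2 * b' := ⟨b / 2, by omega⟩
  obtain ⟨c, rfl⟩ : ∃ c', c = 2 * c' := ⟨c / 2, by omega⟩
  obtain ⟨b', rfl⟩ : ∃ b', b = 2 * b' + 1 := ⟨b / 2, by omega⟩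
  obtain ⟨c', rfl⟩ : ∃ c', c = 2 * c' + 1 := ⟨c / 2, by omega⟩
  have ha : a % 2 = 1 := by
    rcases Int.even_or_odd' a with ⟨a', rfl | rfl⟩
    · obtain ⟨k, hk⟩ : ∃ k, M = 2 * k + 1 := ⟨M / 2, by omega⟩
      rw [hk] at he
      push_cast at he
      ring_nf at he
      omega
    · omega
  obtain ⟨u, hu⟩ : ∃ u : ℤ, M - a = 2 * u := ⟨(M - a) / 2, by omega⟩
  obtain ⟨v, hv⟩ : ∃ v : ℤ, M + a = 2 * v := ⟨(M + a) / 2, by omega⟩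
  have huv : u * v = (2 * b' + 1) ^ 2 + (2 * c' + 1) ^ 2 := by
    have : (2 * u) * (2 * v) = M ^ 2 - a ^ 2 := by rw [← hu, ← hv]; ring
    linarith
  have hpos : 0 < u * v := by
    have : 2 * b' + 1 ≠ 0 := by omega
    rw [huv]; positivity
  have hadd : u + v = M := by linarith
  have hu0 : 0 < u := by
    by_contra! hneg
    have : v < 0 := by nlinarith
    omega
  have hv0 : 0 < v := pos_of_mul_pos_right hpos hu0.le
  lift u to ℕ using hu0.le
  lift v to ℕ using hv0.le
  have hadd' : u + v = M := by exact_mod_cast hadd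
  have hsum : ∃ x y, u * v = x ^ 2 + y ^ 2 := by
    refine ⟨(2 * b' + 1).natAbs, (2 * c' + 1).natAbs, ?_⟩
    zify
    rw [sq_abs, sq_abs, huv]
  have hmod : ∀ x y : ℕ, (x ^ 2 + y ^ 2) % 4 ≠ 3 := by
    intro x y
    rcases Nat.even_or_odd' x with ⟨x', rfl | rfl⟩ <;>
    rcases Nat.even_or_odd' y with ⟨y', rfl | rfl⟩ <;> ring_nf <;> omega
  obtain ⟨x, y, hxy⟩ := Nat.eq_sq_add_sq_of_mul_of_add (by omega) (by omega)
    (hadd' ▸ h) hsum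
  obtain ⟨z, w, hzw⟩ := Nat.eq_sq_add_sq_of_mul_of_add (u := v) (v := u) (by omega) (by omega)
    (add_comm u v ▸ hadd' ▸ h) (mul_comm u v ▸ hsum)
  have hu3 : u % 4 ≠ 3 := hxy ▸ hmod x y
  have hv3 : v % 4 ≠ 3 := hzw ▸ hmod z w
  have huv4 : ((u : ℤ) * v) % 4 = 2 := by rw [huv]; ring_nf; omega
  rw [Int.mul_emod] at huv4
  rcases (show (u : ℤ) % 4 = 0 ∨ (v : ℤ) % 4 = 0 ∨ (u : ℤ) % 4 = 2 ∧ (v : ℤ) % 4 = 3 ∨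
    (u : ℤ) % 4 = 3 ∧ (v : ℤ) % 4 = 2 by omega) with h0 | h0 | ⟨h0, h1⟩ | ⟨h0, h1⟩
  · simp [h0] at huv4
  · simp [h0] at huv4
  · omega
  · omega

lemma exists_sq_eq_add_of_prime {p m : ℕ} (hp4 : p % 4 = 3) (hm : m % 2 = 1) (hpm : p ∣ m) :
    ∃ x y z : ℤ, (m : ℤ) ^ 2 = x ^ 2 + y ^ 2 + z ^ 2 ∧ y % 4 = 2 ∧ z % 4 = 2 := by
  obtain ⟨k, rfl⟩ := hpm
  have hk : k % 2 = 1 := by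
    rw [Nat.mul_mod] at hm
    rcases Nat.mod_two_eq_zero_or_one k with h | h
    · simp [h] at hm
    · exact h
  obtain ⟨a, b, c, d, h⟩ := Nat.sum_four_squares p
  zify at h
  generalize (a : ℤ) = a at h
  generalize (b : ℤ) = b at h
  generalize (c : ℤ) = c at h
  generalize (d : ℤ) = d at h
  have hpar : (a * b - c * d) % 2 = 1 ∧ (a * c + d * b) % 2 = 1 := by
    have h4 : (a ^ 2 + b ^ 2 + c ^ 2 + d ^ 2) % 4 = 3 := by omega
    rcases Int.even_or_odd' a with ⟨a', rfl | rfl⟩ <;>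
    rcases Int.even_or_odd' b with ⟨b', rfl | rfl⟩ <;>
    rcases Int.even_or_odd' c with ⟨c', rfl | rfl⟩ <;>
    rcases Int.even_or_odd' d with ⟨d', rfl | rfl⟩ <;>
    ring_nf at h4 ⊢ <;> omega
  have key : ∀ x : ℤ, x % 2 = 1 → (k * (2 * x)) % 4 = 2 := by
    intro x hx
    have : (k * x) % 2 = 1 := by
      rw [Int.mul_emod, hx, show (k : ℤ) % 2 = 1 by omega]; rfl
    rw [mul_left_comm]; omega
  refine ⟨k * (a ^ 2 + d ^ 2 - b ^ 2 - c ^ 2), k * (2 * (a * b - c * d)),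
    k * (2 * (a * c + d * b)), ?_, key _ hpar.1, key _ hpar.2⟩
  push_cast
  rw [← h]
  ring

/-- A sum of three squares equal to an odd number has, up to order, odd first term and even
other terms. -/
lemma exists_odd_even_even {N a b c : ℤ} (hN : N % 4 = 1) (h : N = a ^ 2 + b ^ 2 + c ^ 2) :
    ∃ x y z : ℤ, N = x ^ 2 + y ^ 2 + z ^ 2 ∧ x % 2 = 1 ∧ y % 2 = 0 ∧ z % 2 = 0 := by
  have : a % 2 = 1 ∧ b % 2 = 0 ∧ c % 2 = 0 ∨ a % 2 = 0 ∧ b % 2 = 1 ∧ c % 2 = 0 ∨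
      a % 2 = 0 ∧ b % 2 = 0 ∧ c % 2 = 1 := by
    rw [h] at hN
    rcases Int.even_or_odd' a with ⟨a', rfl | rfl⟩ <;>
    rcases Int.even_or_odd' b with ⟨b', rfl | rfl⟩ <;>
    rcases Int.even_or_odd' c with ⟨c', rfl | rfl⟩ <;>
    ring_nf at hN ⊢ <;> omega
  rcases this with ⟨h1, h2, h3⟩ | ⟨h1, h2, h3⟩ | ⟨h1, h2, h3⟩
  · exact ⟨a, b, c, h, h1, h2, h3⟩
  · exact ⟨b, a, c, by rw [h]; ring, h2, h1, h3⟩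
  · exact ⟨c, b, a, by rw [h]; ring, h3, h2, h1⟩

lemma Int.sq_emod_eight_of_odd {x : ℤ} (hx : x % 2 = 1) : x ^ 2 % 8 = 1 := by
  obtain ⟨k, rfl⟩ : ∃ k, x = 2 * k + 1 := ⟨x / 2, by omega⟩
  rcases Int.even_or_odd' k with ⟨l, rfl | rfl⟩ <;> ring_nf <;> omega

lemma Int.sq_emod_eight_of_four_dvd {x : ℤ} (hx : x % 4 = 0) : x ^ 2 % 8 = 0 := by
  obtain ⟨k, rfl⟩ : ∃ k, x = 4 * k := ⟨x / 4, by omega⟩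
  ring_nf
  omega

lemma exists_sum_three_sq_of_not_isSquare {N : ℕ} (hN : N % 8 = 1) (hsq : ¬ IsSquare N) :
    ∃ x y z : ℤ, (N : ℤ) = x ^ 2 + y ^ 2 + z ^ 2 ∧ y % 4 = 2 ∧ z % 4 = 2 := by
  have hN1 : 1 < N := by
    rcases (show N = 1 ∨ 1 < N by omega) with rfl | h
    · exact absurd ⟨1, rfl⟩ hsq
    · exact h
  obtain ⟨a, b, c, h⟩ := eq_sum_three_sq_of_mod_four_eq_one hN1 (by omega)
  obtain ⟨x, y, z, h, hx, hy, hz⟩ := exists_odd_even_even (by omega) h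
  have : y % 4 = 0 ∧ z % 4 = 0 ∨ y % 4 = 2 ∧ z % 4 = 2 := by
    have h8 : (x ^ 2 + y ^ 2 + z ^ 2) % 8 = 1 := by omega
    have hx8 : x ^ 2 % 8 = 1 := Int.sq_emod_eight_of_odd hx
    obtain ⟨y', rfl⟩ : ∃ y', y = 2 * y' := ⟨y / 2, by omega⟩
    obtain ⟨z', rfl⟩ : ∃ z', z = 2 * z' := ⟨z / 2, by omega⟩
    rcases Int.even_or_odd' y' with ⟨y', rfl | rfl⟩ <;>
    rcases Int.even_or_odd' z' with ⟨z', rfl | rfl⟩ <;>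
    ring_nf at h8 ⊢ <;> omega
  rcases this with ⟨hy, hz⟩ | ⟨hy, hz⟩
  · obtain ⟨q, t, hq, hq0, hq4, hqt, hqt'⟩ :=
      exists_prime_mod_four_eq_three_dvd_sq_add (by omega) hsq
    rw [h] at hqt ⊢
    exact exists_sum_three_sq_two_mod_four hx hy hz hq hq0 hq4 hqt hqt'
  · exact ⟨x, y, z, h, hy, hz⟩

lemma finite_sq_add_sq_add_two_mul_sq (K : ℤ) (P : ℤ × ℤ × ℤ → Prop) :
    Finite {v : ℤ × ℤ × ℤ // v.1 ^ 2 + v.2.1 ^ 2 + 2 * v.2.2 ^ 2 = K ∧ P v} := by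
  refine Set.Finite.subset (s := Set.Icc (-K) K ×ˢ Set.Icc (-K) K ×ˢ Set.Icc (-K) K)
    ((Set.finite_Icc _ _).prod ((Set.finite_Icc _ _).prod (Set.finite_Icc _ _))) ?_
  rintro ⟨x, y, z⟩ ⟨h, -⟩
  have key : ∀ w : ℤ, w ^ 2 ≤ K → w ∈ Set.Icc (-K) K := fun w hw ↦
    ⟨by nlinarith, by nlinarith⟩
  simp only at h
  exact ⟨key _ (by nlinarith), key _ (by nlinarith), key _ (by nlinarith)⟩

/-- The substitution `(x, y, z) ↦ (x + y, x - y, z)`. -/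
lemma exists_sq_add_sq_add_two_mul_sq {x y z K : ℤ} (h : 2 * (x ^ 2 + y ^ 2 + z ^ 2) = K)
    (hxy : (x + y) % 2 = 1) (hz : z % 4 = 2) :
    ∃ v : ℤ × ℤ × ℤ, v.1 ^ 2 + v.2.1 ^ 2 + 2 * v.2.2 ^ 2 = K ∧
        v.1 ≡ 1 [ZMOD 2] ∧ v.2.1 ≡ 1 [ZMOD 2] ∧ v.2.2 ≡ 2 [ZMOD 4] := by
  refine ⟨(x + y, x - y, z), by rw [← h]; ring, hxy, ?_, hz⟩
  change (x - y) % 2 = 1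
  omega

theorem stmt_16 (n : ℕ) (hn : 0 < n) :
    (Nat.card {v : ℤ × ℤ × ℤ //
        v.1 ^ 2 + v.2.1 ^ 2 + 2 * v.2.2 ^ 2 = 16 * (n : ℤ) + 2 ∧
        v.1 ≡ 1 [ZMOD 2] ∧ v.2.1 ≡ 1 [ZMOD 2] ∧ v.2.2 ≡ 2 [ZMOD 4]} = 0 ↔
      ∃ M : ℕ, 0 < M ∧ 16 * n + 2 = 2 * M ^ 2 ∧ ∀ p : ℕ, p.Prime → p ∣ M → p % 4 = 1) ∧
    0 < Nat.card {v : ℤ × ℤ × ℤ //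
        v.1 ^ 2 + v.2.1 ^ 2 + 2 * v.2.2 ^ 2 = 16 * (n : ℤ) + 10 ∧
        v.1 ≡ 1 [ZMOD 2] ∧ v.2.1 ≡ 1 [ZMOD 2] ∧ v.2.2 ≡ 2 [ZMOD 4]} := by
  have hfin := finite_sq_add_sq_add_two_mul_sq (16 * (n : ℤ) + 2) fun v ↦
    v.1 ≡ 1 [ZMOD 2] ∧ v.2.1 ≡ 1 [ZMOD 2] ∧ v.2.2 ≡ 2 [ZMOD 4]
  have hfin' := finite_sq_add_sq_add_two_mul_sq (16 * (n : ℤ) + 10) fun v ↦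
    v.1 ≡ 1 [ZMOD 2] ∧ v.2.1 ≡ 1 [ZMOD 2] ∧ v.2.2 ≡ 2 [ZMOD 4]
  refine ⟨⟨fun h0 ↦ ?_, ?_⟩, ?_⟩
  · rw [Finite.card_eq_zero_iff] at h0
    have hno : ∀ x y z : ℤ, ((8 * n + 1 : ℕ) : ℤ) = x ^ 2 + y ^ 2 + z ^ 2 → y % 4 = 2 →
        z % 4 = 2 → False := by
      intro x y z h hy hz
      have hx : x % 2 = 1 := by
        rcases Int.even_or_odd' x with ⟨x', rfl | rfl⟩
        · obtain ⟨y', rfl⟩ : ∃ y', y = 2 * y' := ⟨y / 2, by omega⟩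
          obtain ⟨z', rfl⟩ : ∃ z', z = 2 * z' := ⟨z / 2, by omega⟩
          push_cast at h
          ring_nf at h
          omega
        · omega
      obtain ⟨v, hv⟩ := exists_sq_add_sq_add_two_mul_sq (K := 16 * (n : ℤ) + 2)
        (by rw [← h]; push_cast; ring) (by omega : (x + y) % 2 = 1) hz
      exact h0.false ⟨v, hv⟩
    have hsq : IsSquare (8 * n + 1) := by
      by_contra hsq
      obtain ⟨x, y, z, h, hy, hz⟩ := exists_sum_three_sq_of_not_isSquare (by omega) hsq
      exact hno x y z h hy hz
    obtain ⟨M, hM⟩ := hsq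
    have hM2 : M % 2 = 1 := by
      rcases Nat.even_or_odd' M with ⟨k, rfl | rfl⟩
      · ring_nf at hM; omega
      · omega
    refine ⟨M, by omega, by linarith, fun p hp hpM ↦ ?_⟩
    by_contra hp4
    have hp2 : p % 2 = 1 := by
      rcases hp.eq_two_or_odd with rfl | h
      · omega
      · exact h
    obtain ⟨x, y, z, h, hy, hz⟩ := exists_sq_eq_add_of_prime (by omega) hM2 hpM
    exact hno x y z (by rw [hM, ← h]; push_cast; ring) hy hz
  · rintro ⟨M, hM, hMn, hp⟩
    rw [Finite.card_eq_zero_iff]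
    refine ⟨fun ⟨⟨x, y, z⟩, h, hx, hy, hz⟩ ↦ ?_⟩
    simp only [Int.ModEq] at h hx hy hz
    obtain ⟨a, ha⟩ : ∃ a, x + y = 2 * a := ⟨(x + y) / 2, by omega⟩
    obtain ⟨b, hb⟩ : ∃ b, x - y = 2 * b := ⟨(x - y) / 2, by omega⟩
    obtain rfl : x = a + b := by linarith
    obtain rfl : y = a - b := by linarith
    have hMn' : (16 * n + 2 : ℤ) = 2 * M ^ 2 := by exact_mod_cast hMn
    have he : (M : ℤ) ^ 2 = a ^ 2 + b ^ 2 + z ^ 2 := by linarith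
    have h8 : (a ^ 2 + b ^ 2 + z ^ 2) % 8 = 1 := by rw [← he]; omega
    obtain ⟨z', hz'⟩ : ∃ z', z = 4 * z' + 2 := ⟨z / 4, by omega⟩
    have hzsq : z ^ 2 % 8 = 4 := by rw [hz']; ring_nf; omega
    have hcases : a % 4 = 2 ∨ b % 4 = 2 := by
      rcases (show a % 2 = 1 ∧ b % 2 = 0 ∨ a % 2 = 0 ∧ b % 2 = 1 by omega) with
        ⟨h1, h2⟩ | ⟨h1, h2⟩
      · have := Int.sq_emod_eight_of_odd (x := a) h1
        have := Int.sq_emod_eight_of_four_dvd (x := b)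
        omega
      · have := Int.sq_emod_eight_of_odd (x := b) h2
        have := Int.sq_emod_eight_of_four_dvd (x := a)
        omega
    rcases hcases with ha | hb
    · exact sq_ne_add_of_forall_prime hM hp ha hz (he.trans (by ring : _ = b ^ 2 + a ^ 2 + z ^ 2))
    · exact sq_ne_add_of_forall_prime hM hp hb hz he
  · obtain ⟨a, b, c, h⟩ := eq_sum_three_sq_of_mod_four_eq_one (N := 8 * n + 5) (by omega)
      (by omega)
    obtain ⟨x, y, z, h, hx, hy, hz⟩ := exists_odd_even_even (by omega) h
    have hyz : y % 4 = 2 ∨ z % 4 = 2 := by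
      have h8 : (x ^ 2 + y ^ 2 + z ^ 2) % 8 = 5 := by omega
      have hx8 : x ^ 2 % 8 = 1 := Int.sq_emod_eight_of_odd hx
      have := Int.sq_emod_eight_of_four_dvd (x := y)
      have := Int.sq_emod_eight_of_four_dvd (x := z)
      omega
    push_cast at h
    refine Nat.card_pos_iff.2 ⟨?_, hfin'⟩
    rw [nonempty_subtype]
    rcases hyz with hy | hz
    · exact exists_sq_add_sq_add_two_mul_sq (x := x) (y := z) (by linarith) (by omega) hy
    · exact exists_sq_add_sq_add_two_mul_sq (x := x) (y := y) (by linarith) (by omega) hz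
end

section
/- Let n be a positive integer. Then the number of (x,y,z) ∈ ℤ³ with x²+y²+z² = 8n+1, x ≡ 1 (mod 2), y ≡ 0 (mod 2), and z ≡ 2 (mod 4) equals (1/6)·𝔯₁(8n+1) − δ_□(8n+1)·(−1)^((√(8n+1)−1)/2)·√(8n+1). Moreover, the number of (x,y,z) ∈ ℤ³ with x²+y²+z² = 8n+5 and the same congruence conditions equals (1/6)·𝔯₁(8n+5). -/
/-- The number of representations of `k` as a sum of three squares. -/
noncomputable def r1 (k : ℕ) : ℕ :=
  Nat.card {v : ℤ × ℤ × ℤ // v.1 ^ 2 + v.2.1 ^ 2 + v.2.2 ^ 2 = (k : ℤ)}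

/-- `δ_□(k) · (−1)^((√k−1)/2) · √k`, as a rational number. -/
noncomputable def sqTerm (k : ℕ) : ℚ :=
  if IsSquare k then (-1 : ℚ) ^ ((Nat.sqrt k - 1) / 2) * (Nat.sqrt k : ℚ) else 0

/-- The nontrivial character modulo 4, evaluated at an odd integer. -/
def oddSign (s : ℤ) : ℤ := if s % 4 = 1 then 1 else -1

/-- The sign `(-1) ^ (z / 2)` of an even integer `z`. -/
def evenSign (z : ℤ) : ℤ := if z % 4 = 0 then 1 else -1

/-- Odd integers in `[-K, K]` with square `i`. -/
noncomputable def oddRoots (K i : ℤ) : Finset ℤ :=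
  (Finset.Icc (-K) K).filter fun s => s % 2 = 1 ∧ s ^ 2 = i

/-- Representations of `j` by three squares in the box `[-K, K]³`, the first coordinate odd, the
other two even and congruent modulo 4. -/
noncomputable def triples (K j : ℤ) : Finset (ℤ × ℤ × ℤ) :=
  (Finset.Icc (-K) K ×ˢ Finset.Icc (-K) K ×ˢ Finset.Icc (-K) K).filter fun v =>
    (v.1 % 2 = 1 ∧ v.2.1 % 2 = 0 ∧ v.2.2 % 2 = 0 ∧ (v.2.1 - v.2.2) % 4 = 0) ∧
      v.1 ^ 2 + v.2.1 ^ 2 + v.2.2 ^ 2 = j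

/-- Representations of `M` by four squares in a box, an element of `oddRoots` followed by one of
`triples`. -/
noncomputable def quads (K M : ℤ) : Finset (ℤ × ℤ × ℤ × ℤ) :=
  (Finset.Icc (-K) K ×ˢ Finset.Icc (-K) K ×ˢ Finset.Icc (-K) K ×ˢ Finset.Icc (-K) K).filter fun v =>
    (v.1 % 2 = 1 ∧ v.2.1 % 2 = 1 ∧ v.2.2.1 % 2 = 0 ∧ v.2.2.2 % 2 = 0 ∧
      (v.2.2.1 - v.2.2.2) % 4 = 0) ∧ v.1 ^ 2 + v.2.1 ^ 2 + v.2.2.1 ^ 2 + v.2.2.2 ^ 2 = M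

/-- The elements of `quads` whose two odd coordinates are congruent modulo 4. -/
noncomputable def congrQuads (K M : ℤ) : Finset (ℤ × ℤ × ℤ × ℤ) :=
  (quads K M).filter fun v => (v.1 - v.2.1) % 4 = 0

/-- The sign attached to an element of `quads`. -/
def quadSign (v : ℤ × ℤ × ℤ × ℤ) : ℤ := oddSign v.1 * evenSign v.2.2.2

theorem mem_Icc_of_sq_le {K M s : ℤ} (hM : M ≤ K) (h : s ^ 2 ≤ M) : s ∈ Finset.Icc (-K) K := by
  rw [Finset.mem_Icc]
  constructor <;> nlinarith

theorem mem_triples {K j x y z : ℤ} (h : j ≤ K) :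
    (x, y, z) ∈ triples K j ↔ (x % 2 = 1 ∧ y % 2 = 0 ∧ z % 2 = 0 ∧ (y - z) % 4 = 0) ∧
      x ^ 2 + y ^ 2 + z ^ 2 = j := by
  simp only [triples, Finset.mem_filter, Finset.mem_product, and_iff_right_iff_imp]
  rintro ⟨-, e⟩
  exact ⟨mem_Icc_of_sq_le h (by nlinarith), mem_Icc_of_sq_le h (by nlinarith),
    mem_Icc_of_sq_le h (by nlinarith)⟩

theorem mem_quads {K M s x y z : ℤ} (h : M ≤ K) :
    (s, x, y, z) ∈ quads K M ↔
      (s % 2 = 1 ∧ x % 2 = 1 ∧ y % 2 = 0 ∧ z % 2 = 0 ∧ (y - z) % 4 = 0) ∧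
        s ^ 2 + x ^ 2 + y ^ 2 + z ^ 2 = M := by
  simp only [quads, Finset.mem_filter, Finset.mem_product, and_iff_right_iff_imp]
  rintro ⟨-, e⟩
  exact ⟨mem_Icc_of_sq_le h (by nlinarith), mem_Icc_of_sq_le h (by nlinarith),
    mem_Icc_of_sq_le h (by nlinarith), mem_Icc_of_sq_le h (by nlinarith)⟩

theorem mem_congrQuads {K M s x y z : ℤ} (h : M ≤ K) :
    (s, x, y, z) ∈ congrQuads K M ↔
      ((s % 2 = 1 ∧ x % 2 = 1 ∧ y % 2 = 0 ∧ z % 2 = 0 ∧ (y - z) % 4 = 0) ∧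
        s ^ 2 + x ^ 2 + y ^ 2 + z ^ 2 = M) ∧ (s - x) % 4 = 0 := by
  rw [congrQuads, Finset.mem_filter, mem_quads h]

theorem evenSign_neg (z : ℤ) : evenSign (-z) = evenSign z := by
  unfold evenSign; split_ifs <;> omega

theorem sum_congrQuads_swap {K M : ℤ} (h : M ≤ K) (p : ℤ × ℤ × ℤ × ℤ → ℤ) :
    ∑ v ∈ congrQuads K M, quadSign v * p v =
      ∑ v ∈ congrQuads K M, quadSign v * p (v.2.1, v.1, v.2.2.1, v.2.2.2) := by
  refine Finset.sum_nbij' (fun v => (v.2.1, v.1, v.2.2.1, v.2.2.2))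
    (fun v => (v.2.1, v.1, v.2.2.1, v.2.2.2)) ?_ ?_ (fun _ _ => rfl) (fun _ _ => rfl) ?_ <;>
    rintro ⟨s, x, y, z⟩ hv <;> rw [mem_congrQuads h] at hv
  · dsimp only
    rw [mem_congrQuads h]
    exact ⟨⟨by omega, by linarith⟩, by omega⟩
  · dsimp only
    rw [mem_congrQuads h]
    exact ⟨⟨by omega, by linarith⟩, by omega⟩
  · have : oddSign s = oddSign x := by
      unfold oddSign; split_ifs <;> omega
    simp only [quadSign, this]

theorem sum_congrQuads_neg_third {K M : ℤ} (h : M ≤ K) (p : ℤ × ℤ × ℤ × ℤ → ℤ) :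
    ∑ v ∈ congrQuads K M, quadSign v * p v =
      ∑ v ∈ congrQuads K M, quadSign v * p (v.1, v.2.1, -v.2.2.1, v.2.2.2) := by
  refine Finset.sum_nbij' (fun v => (v.1, v.2.1, -v.2.2.1, v.2.2.2))
    (fun v => (v.1, v.2.1, -v.2.2.1, v.2.2.2)) ?_ ?_ (fun _ _ => by simp) (fun _ _ => by simp) ?_ <;>
    rintro ⟨s, x, y, z⟩ hv <;> rw [mem_congrQuads h] at hv
  · dsimp only
    rw [mem_congrQuads h]
    exact ⟨⟨by omega, by linarith⟩, by omega⟩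
  · dsimp only
    rw [mem_congrQuads h]
    exact ⟨⟨by omega, by linarith⟩, by omega⟩
  · simp only [quadSign, neg_neg]

theorem sum_congrQuads_neg_fourth {K M : ℤ} (h : M ≤ K) (p : ℤ × ℤ × ℤ × ℤ → ℤ) :
    ∑ v ∈ congrQuads K M, quadSign v * p v =
      ∑ v ∈ congrQuads K M, quadSign v * p (v.1, v.2.1, v.2.2.1, -v.2.2.2) := by
  refine Finset.sum_nbij' (fun v => (v.1, v.2.1, v.2.2.1, -v.2.2.2))
    (fun v => (v.1, v.2.1, v.2.2.1, -v.2.2.2)) ?_ ?_ (fun _ _ => by simp) (fun _ _ => by simp) ?_ <;>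
    rintro ⟨s, x, y, z⟩ hv <;> rw [mem_congrQuads h] at hv
  · dsimp only
    rw [mem_congrQuads h]
    exact ⟨⟨by omega, by linarith⟩, by omega⟩
  · dsimp only
    rw [mem_congrQuads h]
    exact ⟨⟨by omega, by linarith⟩, by omega⟩
  · simp only [quadSign, neg_neg, evenSign_neg]

/-- Half of the Hadamard matrix of order 4, acting on integer vectors. -/
def halfHadamard (v : ℤ × ℤ × ℤ × ℤ) : ℤ × ℤ × ℤ × ℤ :=
  ((v.1 + v.2.1 + v.2.2.1 + v.2.2.2) / 2, (v.1 + v.2.1 - v.2.2.1 - v.2.2.2) / 2,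
    (v.1 - v.2.1 + v.2.2.1 - v.2.2.2) / 2, (v.1 - v.2.1 - v.2.2.1 + v.2.2.2) / 2)

theorem exists_param_of_mem_congrQuads {K M : ℤ} {v : ℤ × ℤ × ℤ × ℤ} (h : M ≤ K)
    (hv : v ∈ congrQuads K M) :
    ∃ s a z b : ℤ, v = (s, s + 4 * a, z + 4 * b, z) ∧ s % 2 = 1 ∧ z % 2 = 0 ∧
      s ^ 2 + (s + 4 * a) ^ 2 + (z + 4 * b) ^ 2 + z ^ 2 = M := by
  obtain ⟨s, x, y, z⟩ := v
  rw [mem_congrQuads h] at hv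
  obtain ⟨a, rfl⟩ : ∃ a, x = s + 4 * a := ⟨(x - s) / 4, by omega⟩
  obtain ⟨b, rfl⟩ : ∃ b, y = z + 4 * b := ⟨(y - z) / 4, by omega⟩
  exact ⟨s, a, z, b, rfl, hv.1.1.1, hv.1.1.2.2.2.1, hv.1.2⟩

theorem halfHadamard_param (s a z b : ℤ) :
    halfHadamard (s, s + 4 * a, z + 4 * b, z) =
      (s + 2 * a + z + 2 * b, s + 2 * a - z - 2 * b, -2 * a + 2 * b, -2 * a - 2 * b) := by
  simp only [halfHadamard, Prod.mk.injEq]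
  refine ⟨?_, ?_, ?_, ?_⟩ <;> omega

theorem halfHadamard_mem {K M : ℤ} {v : ℤ × ℤ × ℤ × ℤ} (h : M ≤ K) (hv : v ∈ congrQuads K M) :
    halfHadamard v ∈ congrQuads K M := by
  obtain ⟨s, a, z, b, rfl, hs, hz, e⟩ := exists_param_of_mem_congrQuads h hv
  rw [halfHadamard_param, mem_congrQuads h]
  exact ⟨⟨by omega, by linarith⟩, by omega⟩

theorem halfHadamard_halfHadamard {K M : ℤ} {v : ℤ × ℤ × ℤ × ℤ} (h : M ≤ K)
    (hv : v ∈ congrQuads K M) : halfHadamard (halfHadamard v) = v := by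
  obtain ⟨s, a, z, b, rfl, hs, hz, e⟩ := exists_param_of_mem_congrQuads h hv
  rw [halfHadamard_param]
  simp only [halfHadamard, Prod.mk.injEq]
  refine ⟨?_, ?_, ?_, ?_⟩ <;> omega

theorem quadSign_halfHadamard {K M : ℤ} {v : ℤ × ℤ × ℤ × ℤ} (h : M ≤ K)
    (hv : v ∈ congrQuads K M) : quadSign (halfHadamard v) = quadSign v := by
  obtain ⟨s, a, z, b, rfl, hs, hz, e⟩ := exists_param_of_mem_congrQuads h hv
  rw [halfHadamard_param]
  simp only [quadSign, oddSign, evenSign]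
  split_ifs <;> omega

theorem sum_congrQuads_halfHadamard {K M : ℤ} (h : M ≤ K) (p : ℤ × ℤ × ℤ × ℤ → ℤ) :
    ∑ v ∈ congrQuads K M, quadSign v * p v =
      ∑ v ∈ congrQuads K M, quadSign v * p (halfHadamard v) := by
  refine Finset.sum_nbij' halfHadamard halfHadamard (fun _ => halfHadamard_mem h)
    (fun _ => halfHadamard_mem h) (fun _ => halfHadamard_halfHadamard h)
    (fun _ => halfHadamard_halfHadamard h) fun v hv => ?_
  rw [quadSign_halfHadamard h hv, halfHadamard_halfHadamard h hv]

/-- The cubic harmonic polynomial `s (s² - x² - y² - z²)` sums to zero over `congrQuads`. -/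
theorem sum_congrQuads_harmonic {K M : ℤ} (h : M ≤ K) :
    ∑ v ∈ congrQuads K M,
      quadSign v * (v.1 * (v.1 ^ 2 - (v.2.1 ^ 2 + v.2.2.1 ^ 2 + v.2.2.2 ^ 2))) = 0 := by
  have h1 := sum_congrQuads_halfHadamard h fun v => v.1 ^ 3
  have h2 := sum_congrQuads_neg_third h fun v => (halfHadamard v).1 ^ 3
  have h3 := sum_congrQuads_neg_fourth h fun v => (halfHadamard v).1 ^ 3
  have h4 := sum_congrQuads_neg_third h fun v =>
    (halfHadamard (v.1, v.2.1, v.2.2.1, -v.2.2.2)).1 ^ 3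
  have h5 := sum_congrQuads_swap h fun v =>
    v.1 ^ 3 + 3 * v.1 * v.2.1 ^ 2 + 3 * v.1 * (v.2.2.1 ^ 2 + v.2.2.2 ^ 2)
  have key : ∀ v ∈ congrQuads K M,
      6 * (quadSign v * (v.1 * (v.1 ^ 2 - (v.2.1 ^ 2 + v.2.2.1 ^ 2 + v.2.2.2 ^ 2)))) =
      8 * (quadSign v * v.1 ^ 3) - 2 * (quadSign v * (halfHadamard v).1 ^ 3)
      - 2 * (quadSign v * (halfHadamard (v.1, v.2.1, -v.2.2.1, v.2.2.2)).1 ^ 3)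
      - 2 * (quadSign v * (halfHadamard (v.1, v.2.1, v.2.2.1, -v.2.2.2)).1 ^ 3)
      - 2 * (quadSign v * (halfHadamard (v.1, v.2.1, -v.2.2.1, -v.2.2.2)).1 ^ 3)
      + (quadSign v * (v.2.1 ^ 3 + 3 * v.2.1 * v.1 ^ 2 + 3 * v.2.1 * (v.2.2.1 ^ 2 + v.2.2.2 ^ 2)))
      - (quadSign v * (v.1 ^ 3 + 3 * v.1 * v.2.1 ^ 2 +
          3 * v.1 * (v.2.2.1 ^ 2 + v.2.2.2 ^ 2))) := by
    intro v hv
    obtain ⟨s, a, z, b, rfl, hs, hz, e⟩ := exists_param_of_mem_congrQuads h hv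
    have e1 : (s + (s + 4 * a) + (z + 4 * b) + z) / 2 = s + 2 * a + z + 2 * b := by omega
    have e2 : (s + (s + 4 * a) + -(z + 4 * b) + z) / 2 = s + 2 * a - 2 * b := by omega
    have e3 : (s + (s + 4 * a) + (z + 4 * b) + -z) / 2 = s + 2 * a + 2 * b := by omega
    have e4 : (s + (s + 4 * a) + -(z + 4 * b) + -z) / 2 = s + 2 * a - z - 2 * b := by omega
    simp only [halfHadamard, e1, e2, e3, e4]
    ring
  have := Finset.sum_congr rfl key
  simp only [Finset.sum_add_distrib, Finset.sum_sub_distrib, ← Finset.mul_sum] at this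
  simp only at h1 h2 h3 h4 h5
  linarith

theorem sum_quads_harmonic {K M : ℤ} (h : M ≤ K) :
    ∑ v ∈ quads K M,
      quadSign v * (v.1 * (v.1 ^ 2 - (v.2.1 ^ 2 + v.2.2.1 ^ 2 + v.2.2.2 ^ 2))) = 0 := by
  rw [← Finset.sum_filter_add_sum_filter_not _ fun v => (v.1 - v.2.1) % 4 = 0]
  refine Eq.trans (congrArg₂ (· + ·) (sum_congrQuads_harmonic h) ?_) (add_zero 0)
  refine Eq.trans ?_ (sum_congrQuads_harmonic h)
  refine Finset.sum_nbij' (fun v => (v.1, -v.2.1, v.2.2.1, v.2.2.2))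
    (fun v => (v.1, -v.2.1, v.2.2.1, v.2.2.2)) ?_ ?_ (fun _ _ => by simp) (fun _ _ => by simp) ?_ <;>
    rintro ⟨s, x, y, z⟩ hv
  · rw [Finset.mem_filter, mem_quads h] at hv
    dsimp only at hv ⊢
    rw [mem_congrQuads h]
    exact ⟨⟨by omega, by linarith⟩, by omega⟩
  · rw [mem_congrQuads h] at hv
    dsimp only
    rw [Finset.mem_filter, mem_quads h]
    exact ⟨⟨by omega, by linarith⟩, by dsimp only; omega⟩
  · simp only [quadSign, neg_sq]

/-- The coefficients of the derivative of the odd theta function. -/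
noncomputable def thetaDeriv (K i : ℤ) : ℤ := ∑ s ∈ oddRoots K i, oddSign s * s

/-- The coefficients of the product of the three even theta constants. -/
noncomputable def thetaProd (K j : ℤ) : ℤ := ∑ v ∈ triples K j, evenSign v.2.2

theorem sum_thetaDeriv_mul_thetaProd {K M : ℤ} (h : M ≤ K) :
    ∑ i ∈ Finset.Icc 0 M, thetaDeriv K i * thetaProd K (M - i) * (i - (M - i)) = 0 := by
  refine Eq.trans ?_ (sum_quads_harmonic h)
  have : ∀ v ∈ quads K M, v.1 ^ 2 ∈ Finset.Icc 0 M := by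
    rintro ⟨s, x, y, z⟩ hv
    rw [mem_quads h] at hv
    rw [Finset.mem_Icc]
    constructor <;> nlinarith
  rw [← Finset.sum_fiberwise_of_maps_to this]
  refine Finset.sum_congr rfl fun i hi => ?_
  rw [thetaDeriv, thetaProd, Finset.sum_mul_sum, ← Finset.sum_product', Finset.sum_mul]
  have hset : (quads K M).filter (fun v => v.1 ^ 2 = i) = oddRoots K i ×ˢ triples K (M - i) := by
    ext ⟨s, x, y, z⟩
    simp only [quads, oddRoots, triples, Finset.mem_filter, Finset.mem_product]
    constructor
    · rintro ⟨⟨⟨a, b, c, d⟩, ⟨e, f, g, k, l⟩, m⟩, n⟩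
      exact ⟨⟨a, e, n⟩, ⟨b, c, d⟩, ⟨f, g, k, l⟩, by linarith⟩
    · rintro ⟨⟨a, e, n⟩, ⟨b, c, d⟩, ⟨f, g, k, l⟩, m⟩
      exact ⟨⟨⟨a, b, c, d⟩, ⟨e, f, g, k, l⟩, by linarith⟩, n⟩
  rw [hset]
  refine Finset.sum_congr rfl ?_
  rintro ⟨s, x, y, z⟩ hv
  simp only [oddRoots, triples, Finset.mem_filter, Finset.mem_product] at hv
  simp only [quadSign]
  rw [hv.2.2.2, hv.1.2.2]
  ring

theorem thetaDeriv_zero (K : ℤ) : thetaDeriv K 0 = 0 := by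
  refine Finset.sum_eq_zero fun s hs => ?_
  simp only [oddRoots, Finset.mem_filter, sq_eq_zero_iff] at hs
  rw [hs.2.2, mul_zero]

theorem thetaProd_zero (K : ℤ) : thetaProd K 0 = 0 := by
  refine Finset.sum_eq_zero ?_
  rintro ⟨x, y, z⟩ hv
  simp only [triples, Finset.mem_filter] at hv
  have : x = 0 := by nlinarith [hv.2.2]
  omega

theorem thetaDeriv_one {K : ℤ} (h : 1 ≤ K) : thetaDeriv K 1 = 2 := by
  have : oddRoots K 1 = {1, -1} := by
    ext s
    simp only [oddRoots, Finset.mem_filter, Finset.mem_Icc, Finset.mem_insert,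
      Finset.mem_singleton]
    have : s ^ 2 = 1 ↔ s = 1 ∨ s = -1 := by
      rw [← sq_eq_sq_iff_eq_or_eq_neg, one_pow]
    omega
  rw [thetaDeriv, this]
  decide

theorem thetaProd_one {K : ℤ} (h : 1 ≤ K) : thetaProd K 1 = 2 := by
  have : triples K 1 = {(1, 0, 0), (-1, 0, 0)} := by
    ext ⟨x, y, z⟩
    rw [mem_triples h]
    simp only [Finset.mem_insert, Finset.mem_singleton, Prod.mk.injEq]
    constructor
    · rintro ⟨hp, e⟩
      have hx : 0 < x ^ 2 := by
        have : x ≠ 0 := by omega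
        positivity
      have hy : y = 0 := by nlinarith
      have hz : z = 0 := by nlinarith
      have : x ^ 2 = 1 := by subst hy hz; linarith
      rcases eq_or_eq_neg_of_sq_eq_sq x 1 (by simpa using this) with h | h <;> omega
    · rintro (⟨rfl, rfl, rfl⟩ | ⟨rfl, rfl, rfl⟩) <;> decide
  rw [thetaProd, this]
  decide

/-- Jacobi's derivative formula `θ₁' = θ₂ θ₃ θ₄`, in terms of coefficients. -/
theorem thetaDeriv_eq_thetaProd (K : ℤ) (N : ℕ) (hN : (N : ℤ) + 1 ≤ K) :
    thetaDeriv K N = thetaProd K N := by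
  induction N using Nat.strong_induction_on with
  | _ N ih =>
  rcases N with _ | _ | N
  · simp [thetaDeriv_zero, thetaProd_zero]
  · push_cast at hN ⊢
    rw [thetaDeriv_one (by linarith), thetaProd_one (by linarith)]
  · push_cast at hN ⊢
    have hsum := sum_thetaDeriv_mul_thetaProd hN
    set M : ℤ := N + 1 + 1 + 1 with hM
    have hanti : ∑ i ∈ Finset.Icc 0 M, thetaProd K i * thetaProd K (M - i) * (i - (M - i)) =
        -∑ i ∈ Finset.Icc 0 M, thetaProd K i * thetaProd K (M - i) * (i - (M - i)) := by
      rw [← Finset.sum_neg_distrib]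
      refine Finset.sum_nbij' (M - ·) (M - ·) ?_ ?_ (fun _ _ => by simp) (fun _ _ => by simp)
        fun i _ => ?_
      · intro i hi
        rw [Finset.mem_Icc] at hi ⊢
        omega
      · intro i hi
        rw [Finset.mem_Icc] at hi ⊢
        omega
      · rw [sub_sub_cancel]
        ring
    have hdiff : ∑ i ∈ Finset.Icc 0 M,
        (thetaDeriv K i - thetaProd K i) * thetaProd K (M - i) * (i - (M - i)) = 0 := by
      have hexp : ∀ a b c d : ℤ, (a - b) * c * d = a * c * d - b * c * d := fun _ _ _ _ => by ring
      simp only [hexp _ _ _ (_ - _), Finset.sum_sub_distrib]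
      linarith
    rw [Finset.sum_eq_single (M - 1)] at hdiff
    · rw [sub_sub_cancel, thetaProd_one (by linarith)] at hdiff
      have h1 : (M - 1 - 1 : ℤ) ≠ 0 := by omega
      have h2 : thetaDeriv K (M - 1) - thetaProd K (M - 1) = 0 := by simpa [h1] using hdiff
      rw [hM, add_sub_cancel_right] at h2
      linarith
    · intro i hi hne
      rw [Finset.mem_Icc] at hi
      rcases hi.2.eq_or_lt with rfl | hlt
      · rw [sub_self, thetaProd_zero, mul_zero, zero_mul]
      · lift i to ℕ using hi.1
        rw [ih i (by omega) (by omega), sub_self, zero_mul, zero_mul]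
    · intro hnot
      exact absurd (Finset.mem_Icc.2 ⟨by omega, by omega⟩) hnot

theorem oddSign_neg {s : ℤ} (hs : s % 2 = 1) : oddSign (-s) = -oddSign s := by
  unfold oddSign; split_ifs <;> omega

theorem oddSign_mul_natCast {r : ℕ} (hr : r % 2 = 1) :
    oddSign r * r = (-1) ^ ((r - 1) / 2) * r := by
  congr 1
  obtain ⟨m, rfl⟩ : ∃ m, r = 2 * m + 1 := ⟨r / 2, by omega⟩
  have hm : (2 * m + 1 - 1) / 2 = m := by omega
  rw [hm, oddSign]
  rcases Nat.even_or_odd' m with ⟨k, rfl | rfl⟩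
  · rw [if_pos (by omega), Even.neg_one_pow ⟨k, by ring⟩]
  · rw [if_neg (by omega), Odd.neg_one_pow ⟨k, by ring⟩]

theorem thetaDeriv_eq_sqTerm {K : ℤ} {N : ℕ} (hN : (N : ℤ) ≤ K) (hodd : N % 2 = 1) :
    (thetaDeriv K N : ℚ) = 2 * sqTerm N := by
  by_cases hsq : IsSquare N
  · obtain ⟨r, rfl⟩ := hsq
    have hr : r % 2 = 1 := by
      rcases Nat.mod_two_eq_zero_or_one r with h | h
      · simp [Nat.mul_mod, h] at hodd
      · exact h
    have hroots : oddRoots K ((r * r : ℕ) : ℤ) = {(r : ℤ), -(r : ℤ)} := by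
      ext s
      simp only [oddRoots, Finset.mem_filter, Finset.mem_insert, Finset.mem_singleton]
      rw [← sq_eq_sq_iff_eq_or_eq_neg]
      push_cast at hN ⊢
      constructor
      · rintro ⟨-, -, h⟩
        linarith
      · intro h
        refine ⟨mem_Icc_of_sq_le hN (by linarith), ?_, by linarith⟩
        rcases sq_eq_sq_iff_eq_or_eq_neg.1 h with rfl | rfl <;> omega
    rw [thetaDeriv, hroots, Finset.sum_pair (by omega), oddSign_neg (by omega), neg_mul_neg,
      oddSign_mul_natCast hr, sqTerm, if_pos ⟨r, rfl⟩, Nat.sqrt_eq]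
    push_cast
    ring
  · rw [sqTerm, if_neg hsq, mul_zero, Int.cast_eq_zero]
    refine Finset.sum_eq_zero fun s hs => ?_
    simp only [oddRoots, Finset.mem_filter] at hs
    refine absurd ⟨s.natAbs, ?_⟩ hsq
    zify
    rw [← hs.2.2, ← sq, sq_abs]

/-- Representations of `N` by three squares in a box. -/
noncomputable def squareTriples (N : ℤ) : Finset (ℤ × ℤ × ℤ) :=
  (Finset.Icc (-N) N ×ˢ Finset.Icc (-N) N ×ˢ Finset.Icc (-N) N).filter fun v =>
    v.1 ^ 2 + v.2.1 ^ 2 + v.2.2 ^ 2 = N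

theorem mem_squareTriples {N : ℤ} {v : ℤ × ℤ × ℤ} :
    v ∈ squareTriples N ↔ v.1 ^ 2 + v.2.1 ^ 2 + v.2.2 ^ 2 = N := by
  simp only [squareTriples, Finset.mem_filter, Finset.mem_product, and_iff_right_iff_imp]
  intro e
  exact ⟨mem_Icc_of_sq_le le_rfl (by nlinarith), mem_Icc_of_sq_le le_rfl (by nlinarith),
    mem_Icc_of_sq_le le_rfl (by nlinarith)⟩

theorem r1_eq_card (N : ℕ) : r1 N = (squareTriples N).card :=
  Nat.subtype_card _ fun _ => mem_squareTriples

theorem sq_emod_eight (x : ℤ) :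
    x % 2 = 1 ∧ x ^ 2 % 8 = 1 ∨ x % 4 = 0 ∧ x ^ 2 % 8 = 0 ∨ x % 4 = 2 ∧ x ^ 2 % 8 = 4 := by
  have h : x % 8 = 0 ∨ x % 8 = 1 ∨ x % 8 = 2 ∨ x % 8 = 3 ∨ x % 8 = 4 ∨ x % 8 = 5 ∨ x % 8 = 6 ∨
    x % 8 = 7 := by omega
  rcases h with h | h | h | h | h | h | h | h <;> simp [pow_two, Int.mul_emod, h] <;> omega

theorem card_squareTriples {N : ℤ} (hN : N % 4 = 1) :
    (squareTriples N).card = 3 * ((squareTriples N).filter fun v => v.1 % 2 = 1).card := by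
  have hmod : ∀ v ∈ squareTriples N, v.1 % 2 = 1 ∧ v.2.1 % 2 = 0 ∧ v.2.2 % 2 = 0 ∨
      v.1 % 2 = 0 ∧ v.2.1 % 2 = 1 ∧ v.2.2 % 2 = 0 ∨
      v.1 % 2 = 0 ∧ v.2.1 % 2 = 0 ∧ v.2.2 % 2 = 1 := by
    rintro ⟨x, y, z⟩ hv
    rw [mem_squareTriples] at hv
    have hx := sq_emod_eight x
    have hy := sq_emod_eight y
    have hz := sq_emod_eight z
    dsimp only at hv ⊢
    omega
  have h2 : ((squareTriples N).filter fun v => v.2.1 % 2 = 1).card =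
      ((squareTriples N).filter fun v => v.1 % 2 = 1).card := by
    refine Finset.card_nbij' (fun v => (v.2.1, v.1, v.2.2)) (fun v => (v.2.1, v.1, v.2.2))
      ?_ ?_ (fun _ _ => rfl) (fun _ _ => rfl) <;> rintro ⟨x, y, z⟩ hv <;>
      simp only [Finset.coe_filter, Set.mem_ofPred_eq, mem_squareTriples] at hv ⊢ <;>
      exact ⟨by linarith, hv.2⟩
  have h3 : ((squareTriples N).filter fun v => v.2.2 % 2 = 1).card =
      ((squareTriples N).filter fun v => v.1 % 2 = 1).card := by
    refine Finset.card_nbij' (fun v => (v.2.2, v.2.1, v.1)) (fun v => (v.2.2, v.2.1, v.1))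
      ?_ ?_ (fun _ _ => rfl) (fun _ _ => rfl) <;> rintro ⟨x, y, z⟩ hv <;>
      simp only [Finset.coe_filter, Set.mem_ofPred_eq, mem_squareTriples] at hv ⊢ <;>
      exact ⟨by linarith, hv.2⟩
  have key : (squareTriples N).card = ((squareTriples N).filter fun v => v.1 % 2 = 1).card +
      ((squareTriples N).filter fun v => v.2.1 % 2 = 1).card +
      ((squareTriples N).filter fun v => v.2.2 % 2 = 1).card := by
    rw [Finset.card_filter, Finset.card_filter, Finset.card_filter, Finset.card_eq_sum_ones,
      ← Finset.sum_add_distrib, ← Finset.sum_add_distrib]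
    refine Finset.sum_congr rfl fun v hv => ?_
    have := hmod v hv
    split_ifs <;> omega
  omega

/-- Representations of `N` by three squares that are odd, even and `2` modulo `4`, in this order. -/
noncomputable def oddEvenTwo (N : ℤ) : Finset (ℤ × ℤ × ℤ) :=
  (squareTriples N).filter fun v => v.1 % 2 = 1 ∧ v.2.1 % 2 = 0 ∧ v.2.2 % 4 = 2

theorem natCard_eq_card_oddEvenTwo (N : ℤ) :
    Nat.card {v : ℤ × ℤ × ℤ // v.1 ^ 2 + v.2.1 ^ 2 + v.2.2 ^ 2 = N ∧
      v.1 ≡ 1 [ZMOD 2] ∧ v.2.1 ≡ 0 [ZMOD 2] ∧ v.2.2 ≡ 2 [ZMOD 4]} = (oddEvenTwo N).card :=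
  Nat.subtype_card _ fun _ => by
    rw [oddEvenTwo, Finset.mem_filter, mem_squareTriples]
    rfl

theorem card_squareTriples_of_emod_eight_eq_five {N : ℤ} (hN : N % 8 = 5) :
    (squareTriples N).card = 6 * (oddEvenTwo N).card := by
  rw [card_squareTriples (by omega)]
  have hswap : ((squareTriples N).filter fun v => v.1 % 2 = 1 ∧ v.2.1 % 4 = 2).card =
      (oddEvenTwo N).card := by
    refine Finset.card_nbij' (fun v => (v.1, v.2.2, v.2.1)) (fun v => (v.1, v.2.2, v.2.1))
      ?_ ?_ (fun _ _ => rfl) (fun _ _ => rfl) <;> rintro ⟨x, y, z⟩ hv <;>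
      simp only [oddEvenTwo, Finset.coe_filter, Set.mem_ofPred_eq, mem_squareTriples] at hv ⊢ <;>
      have hx := sq_emod_eight x <;> have hy := sq_emod_eight y <;>
      have hz := sq_emod_eight z <;> omega
  have key : ((squareTriples N).filter fun v => v.1 % 2 = 1).card =
      ((squareTriples N).filter fun v => v.1 % 2 = 1 ∧ v.2.1 % 4 = 2).card +
        (oddEvenTwo N).card := by
    simp only [oddEvenTwo, Finset.card_filter]
    rw [← Finset.sum_add_distrib]
    refine Finset.sum_congr rfl fun v hv => ?_
    rw [mem_squareTriples] at hv
    have hx := sq_emod_eight v.1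
    have hy := sq_emod_eight v.2.1
    have hz := sq_emod_eight v.2.2
    split_ifs <;> omega
  omega

theorem thetaProd_eq_of_emod_eight_eq_one {K N : ℤ} (hK : N ≤ K) (hN : N % 8 = 1) :
    3 * thetaProd K N = (squareTriples N).card - 6 * (oddEvenTwo N).card := by
  rw [card_squareTriples (by omega)]
  have htriples : triples K N = (squareTriples N).filter fun v => v.1 % 2 = 1 := by
    ext ⟨x, y, z⟩
    rw [mem_triples hK, Finset.mem_filter, mem_squareTriples]
    have hx := sq_emod_eight x
    have hy := sq_emod_eight y
    have hz := sq_emod_eight z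
    dsimp only
    omega
  have key : thetaProd K N = ((squareTriples N).filter fun v => v.1 % 2 = 1).card -
      2 * (oddEvenTwo N).card := by
    rw [thetaProd, htriples, Finset.sum_filter]
    simp only [oddEvenTwo, Finset.card_filter, Nat.cast_sum, Finset.mul_sum]
    rw [← Finset.sum_sub_distrib]
    refine Finset.sum_congr rfl fun v hv => ?_
    rw [mem_squareTriples] at hv
    have hx := sq_emod_eight v.1
    have hy := sq_emod_eight v.2.1
    have hz := sq_emod_eight v.2.2
    unfold evenSign
    split_ifs <;> omega
  push_cast
  linarith


theorem stmt_17 (n : ℕ) (hn : 0 < n) :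
    (Nat.card {v : ℤ × ℤ × ℤ //
        v.1 ^ 2 + v.2.1 ^ 2 + v.2.2 ^ 2 = 8 * (n : ℤ) + 1 ∧
        v.1 ≡ 1 [ZMOD 2] ∧ v.2.1 ≡ 0 [ZMOD 2] ∧ v.2.2 ≡ 2 [ZMOD 4]} : ℚ) =
      (1 / 6 : ℚ) * r1 (8 * n + 1) - sqTerm (8 * n + 1) ∧
    (Nat.card {v : ℤ × ℤ × ℤ //
        v.1 ^ 2 + v.2.1 ^ 2 + v.2.2 ^ 2 = 8 * (n : ℤ) + 5 ∧
        v.1 ≡ 1 [ZMOD 2] ∧ v.2.1 ≡ 0 [ZMOD 2] ∧ v.2.2 ≡ 2 [ZMOD 4]} : ℚ) =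
      (1 / 6 : ℚ) * r1 (8 * n + 5) := by
  rw [natCard_eq_card_oddEvenTwo, natCard_eq_card_oddEvenTwo, r1_eq_card, r1_eq_card]
  push_cast
  constructor
  · have hprod := thetaProd_eq_of_emod_eight_eq_one (K := 8 * n + 1 + 1) (N := 8 * n + 1)
      (by omega) (by omega)
    have hderiv := thetaDeriv_eq_thetaProd (8 * n + 1 + 1) (8 * n + 1) (by push_cast; rfl)
    have hsq := thetaDeriv_eq_sqTerm (K := 8 * n + 1 + 1) (N := 8 * n + 1) (by push_cast; omega)
      (by omega)
    rw [hderiv] at hsq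
    push_cast at hsq
    have hprod' : (3 * thetaProd (8 * n + 1 + 1) (8 * n + 1) : ℚ) =
        (squareTriples (8 * n + 1)).card - 6 * (oddEvenTwo (8 * n + 1)).card := by
      exact_mod_cast hprod
    linarith
  · have := card_squareTriples_of_emod_eight_eq_five (N := 8 * n + 5) (by omega)
    rw [this]
    push_cast
    ring
end

section
/- Let n be a positive integer. Then the number of (x,y,z) ∈ ℤ³ with x²+y²+z² = 8n+1, x ≡ 1 (mod 2), y ≡ 2 (mod 4), and z ≡ 2 (mod 4) equals (1/6)·𝔯₁(8n+1) − δ_□(8n+1)·(−1)^((√(8n+1)−1)/2)·√(8n+1). -/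
/-- The generating series `∑ᵢ w i * X ^ (D i)` of a weighted family with integer degrees. -/
noncomputable def weightedSeries {ι : Type*} (D : ι → ℤ) (w : ι → ℤ) : PowerSeries ℤ :=
  PowerSeries.mk fun n => ∑ᶠ i, if D i = n then w i else 0

/-- A degree function is nonnegative and has finitely many indices in bounded degree. -/
structure IsDegree {ι : Type*} (D : ι → ℤ) : Prop where
  nonneg : ∀ i, 0 ≤ D i
  finite : ∀ n : ℤ, {i | D i ≤ n}.Finite

lemma IsDegree.prod {ι κ : Type*} {D : ι → ℤ} {E : κ → ℤ} (hD : IsDegree D) (hE : IsDegree E) :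
    IsDegree fun p : ι × κ => D p.1 + E p.2 where
  nonneg p := add_nonneg (hD.nonneg _) (hE.nonneg _)
  finite n := ((hD.finite n).prod (hE.finite n)).subset fun p hp => by
    have h1 := hD.nonneg p.1
    have h2 := hE.nonneg p.2
    simp only [Set.mem_ofPred_eq, Set.mem_prod] at hp ⊢
    omega

lemma IsDegree.comp_injective {ι κ : Type*} {D : ι → ℤ} (hD : IsDegree D) {f : κ → ι}
    (hf : Function.Injective f) : IsDegree fun j => D (f j) where
  nonneg _ := hD.nonneg _
  finite n := Set.Finite.preimage (s := {i | D i ≤ n}) hf.injOn (hD.finite n)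

lemma coeff_weightedSeries {ι : Type*} (D w : ι → ℤ) (n : ℕ) :
    PowerSeries.coeff n (weightedSeries D w) = ∑ᶠ i, if D i = n then w i else 0 :=
  PowerSeries.coeff_mk _ _

lemma coeff_weightedSeries_eq_sum {ι : Type*} (D w : ι → ℤ) (n : ℕ) (s : Finset ι)
    (hs : ∀ i, D i = n → i ∈ s) :
    PowerSeries.coeff n (weightedSeries D w) = ∑ i ∈ s, if D i = n then w i else 0 := by
  rw [coeff_weightedSeries]
  apply finsum_eq_sum_of_support_subset
  intro i hi
  by_contra h
  exact hi (if_neg fun h' => h (hs i h'))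

lemma weightedSeries_comp_equiv {ι κ : Type*} (e : κ ≃ ι) (D w : ι → ℤ) :
    weightedSeries (fun j => D (e j)) (fun j => w (e j)) = weightedSeries D w := by
  ext n
  simp only [coeff_weightedSeries]
  exact finsum_comp_equiv e (f := fun i => if D i = n then w i else 0)

lemma weightedSeries_neg {ι : Type*} (D w : ι → ℤ) :
    weightedSeries D (fun i => -w i) = -weightedSeries D w := by
  ext n
  simp only [map_neg, coeff_weightedSeries, ← finsum_neg_distrib]
  congr! 2 with i
  split_ifs <;> simp

lemma weightedSeries_add {ι : Type*} {D : ι → ℤ} (hD : IsDegree D) (v w : ι → ℤ) :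
    weightedSeries D (fun i => v i + w i) = weightedSeries D v + weightedSeries D w := by
  ext n
  have hs : ∀ i, D i = n → i ∈ (hD.finite n).toFinset := fun i hi => by simp [hi]
  simp only [map_add, coeff_weightedSeries_eq_sum _ _ n _ hs, ← Finset.sum_add_distrib]
  refine Finset.sum_congr rfl fun i _ => ?_
  split_ifs <;> simp

lemma weightedSeries_eq_zero_of_equiv {ι : Type*} {D w : ι → ℤ} (e : ι ≃ ι)
    (hD : ∀ i, D (e i) = D i) (hw : ∀ i, w (e i) = -w i) : weightedSeries D w = 0 := by
  have h : _ = weightedSeries D w := weightedSeries_comp_equiv e D w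
  simp only [hD, hw, weightedSeries_neg] at h
  ext n
  have := congrArg (PowerSeries.coeff n) h
  change -PowerSeries.coeff n (weightedSeries D w) = _ at this
  rw [map_zero]
  omega

lemma weightedSeries_sum {ι κ : Type*} {D : ι ⊕ κ → ℤ} (hD : IsDegree D) (w : ι ⊕ κ → ℤ) :
    weightedSeries D w = weightedSeries (fun i => D (.inl i)) (fun i => w (.inl i)) +
      weightedSeries (fun j => D (.inr j)) (fun j => w (.inr j)) := by
  ext n
  have h1 := (hD.comp_injective Sum.inl_injective).finite n
  have h2 := (hD.comp_injective Sum.inr_injective).finite n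
  rw [map_add, coeff_weightedSeries_eq_sum _ _ n h1.toFinset (by simp +contextual),
    coeff_weightedSeries_eq_sum _ _ n h2.toFinset (by simp +contextual),
    coeff_weightedSeries_eq_sum _ _ n (h1.toFinset.disjSum h2.toFinset)
      (by rintro (i | i) hi <;> simp [hi]), Finset.sum_disjSum]

lemma weightedSeries_mul {ι κ : Type*} {D : ι → ℤ} {E : κ → ℤ} (hD : IsDegree D)
    (hE : IsDegree E) (v : ι → ℤ) (w : κ → ℤ) :
    weightedSeries D v * weightedSeries E w =
      weightedSeries (fun p : ι × κ => D p.1 + E p.2) (fun p => v p.1 * w p.2) := by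
  ext n
  set s := (hD.finite n).toFinset with hs
  set t := (hE.finite n).toFinset with ht
  rw [PowerSeries.coeff_mul, coeff_weightedSeries_eq_sum _ _ n (s ×ˢ t)]
  · have key : ∀ x ∈ Finset.HasAntidiagonal.antidiagonal n,
        PowerSeries.coeff x.1 (weightedSeries D v) * PowerSeries.coeff x.2 (weightedSeries E w) =
        ∑ p ∈ s ×ˢ t, if D p.1 = x.1 ∧ E p.2 = x.2 then v p.1 * w p.2 else 0 := by
      intro x hx
      rw [Finset.HasAntidiagonal.mem_antidiagonal] at hx
      rw [coeff_weightedSeries_eq_sum _ _ x.1 s, coeff_weightedSeries_eq_sum _ _ x.2 t,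
        Finset.sum_mul_sum, Finset.sum_product]
      · refine Finset.sum_congr rfl fun i _ => Finset.sum_congr rfl fun j _ => ?_
        split_ifs <;> simp_all
      · intro j hj
        simp [ht]
        omega
      · intro j hj
        simp [hs]
        omega
    rw [Finset.sum_congr rfl key, Finset.sum_comm]
    refine Finset.sum_congr rfl fun p _ => ?_
    have h1 := hD.nonneg p.1
    have h2 := hE.nonneg p.2
    split_ifs with h
    · rw [Finset.sum_eq_single ((D p.1).toNat, (E p.2).toNat)]
      · rw [if_pos]
        simp [h1, h2]
      · rintro ⟨a, b⟩ _ hne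
        rw [if_neg]
        rintro ⟨ha, hb⟩
        apply hne
        simp_all
      · intro hn
        exfalso
        apply hn
        rw [Finset.HasAntidiagonal.mem_antidiagonal]
        show (D p.1).toNat + (E p.2).toNat = n
        omega
    · refine Finset.sum_eq_zero fun x hx => ?_
      rw [Finset.HasAntidiagonal.mem_antidiagonal] at hx
      rw [if_neg]
      omega
  · intro p hp
    have h1 := hD.nonneg p.1
    have h2 := hE.nonneg p.2
    simp [hs, ht]
    omega

lemma expand_weightedSeries {ι : Type*} {D : ι → ℤ} (w : ι → ℤ) :
    PowerSeries.expand 2 two_ne_zero (weightedSeries D w) =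
      weightedSeries (fun i => 2 * D i) w := by
  ext n
  by_cases h : 2 ∣ n
  · obtain ⟨k, rfl⟩ := h
    rw [PowerSeries.coeff_expand_mul, coeff_weightedSeries, coeff_weightedSeries]
    congr! 3
    omega
  · rw [PowerSeries.coeff_expand_of_not_dvd _ _ _ h, coeff_weightedSeries, eq_comm]
    apply finsum_eq_zero_of_forall_eq_zero
    intro i
    rw [if_neg]
    omega

lemma isDegree_of_abs_le {D : ℤ → ℤ} (hD : ∀ m, 0 ≤ D m)
    (h : ∀ m : ℤ, |m| ≤ D m + 1) : IsDegree D where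
  nonneg := hD
  finite n := (Set.finite_Icc (-(n + 1)) (n + 1)).subset fun m hm => by
    have := abs_le.mp (h m)
    simp only [Set.mem_ofPred_eq, Set.mem_Icc] at hm ⊢
    omega

lemma isDegree_pronic : IsDegree fun m : ℤ => m ^ 2 + m :=
  isDegree_of_abs_le (fun m => by rcases le_or_gt 0 m with h | h <;> nlinarith)
    fun m => abs_le.mpr ⟨by nlinarith [sq_nonneg (m + 1)], by nlinarith [sq_nonneg m]⟩

lemma isDegree_two_mul_sq : IsDegree fun m : ℤ => 2 * m ^ 2 :=
  isDegree_of_abs_le (fun m => by positivity)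
    fun m => abs_le.mpr ⟨by nlinarith [sq_nonneg (m + 1)], by nlinarith [sq_nonneg (m - 1)]⟩

/-- The sign `(-1) ^ m` as an integer. -/
def altSign (m : ℤ) : ℤ := (m.negOnePow : ℤˣ)

lemma altSign_add (a b : ℤ) : altSign (a + b) = altSign a * altSign b := by
  simp [altSign, Int.negOnePow_add]

@[simp] lemma altSign_neg (a : ℤ) : altSign (-a) = altSign a := by
  simp [altSign, Int.negOnePow_neg]

@[simp] lemma altSign_one : altSign 1 = -1 := by simp [altSign]

lemma altSign_sub (a b : ℤ) : altSign (a - b) = altSign a * altSign b := by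
  rw [sub_eq_add_neg, altSign_add, altSign_neg]

/-- The equivalence splitting pairs of integers by the parity of their sum: `(k, l)` gives
`(k + l, k - l)` and `(k + l, -1 - (k - l))`. -/
noncomputable def paritySplit : (ℤ × ℤ) ⊕ (ℤ × ℤ) ≃ ℤ × ℤ :=
  Equiv.ofBijective
    (Sum.elim (fun p => (p.1 + p.2, p.1 - p.2)) (fun p => (p.1 + p.2, -1 - (p.1 - p.2)))) <| by
    constructor
    · rintro (⟨a, b⟩ | ⟨a, b⟩) (⟨c, d⟩ | ⟨c, d⟩) h <;>
        simp only [Sum.elim_inl, Sum.elim_inr, Prod.mk.injEq, Sum.inl.injEq, Sum.inr.injEq,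
          reduceCtorEq] at h ⊢ <;> omega
    · rintro ⟨x, y⟩
      rcases Int.even_or_odd' (x + y) with ⟨k, hk | hk⟩
      · exact ⟨.inl (k, x - k), by simp; omega⟩
      · exact ⟨.inr (x - k - 1, k + 1), by simp; omega⟩

lemma weightedSeries_paritySplit {D : ℤ × ℤ → ℤ} (hD : IsDegree D) (w : ℤ × ℤ → ℤ) :
    weightedSeries D w =
      weightedSeries (fun p : ℤ × ℤ => D (p.1 + p.2, p.1 - p.2)) (fun p => w (p.1 + p.2, p.1 - p.2)) +
      weightedSeries (fun p : ℤ × ℤ => D (p.1 + p.2, -1 - (p.1 - p.2)))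
        (fun p => w (p.1 + p.2, -1 - (p.1 - p.2))) := by
  rw [← weightedSeries_comp_equiv paritySplit,
    weightedSeries_sum (hD.comp_injective paritySplit.injective)]
  rfl

/-- `∑ X ^ (m ^ 2 + m)`. -/
noncomputable def psiSeries : PowerSeries ℤ := weightedSeries (fun m : ℤ => m ^ 2 + m) fun _ => 1

/-- `∑ X ^ (2 * m ^ 2)`. -/
noncomputable def phiSeries : PowerSeries ℤ := weightedSeries (fun m : ℤ => 2 * m ^ 2) fun _ => 1

/-- `∑ (-1) ^ m * X ^ (2 * m ^ 2)`. -/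
noncomputable def altPhiSeries : PowerSeries ℤ := weightedSeries (fun m : ℤ => 2 * m ^ 2) altSign

/-- `∑ (-1) ^ m * (2 * m + 1) * X ^ (m ^ 2 + m)`. -/
noncomputable def jacobiSeries : PowerSeries ℤ :=
  weightedSeries (fun m : ℤ => m ^ 2 + m) fun m => altSign m * (2 * m + 1)

local notation "dbl" => PowerSeries.expand (R := ℤ) 2 two_ne_zero

lemma isDegree_two_mul_pronic : IsDegree fun m : ℤ => 2 * (m ^ 2 + m) :=
  isDegree_of_abs_le (fun m => mul_nonneg two_pos.le (isDegree_pronic.nonneg m))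
    fun m => by
      have h := isDegree_pronic.nonneg m
      exact abs_le.mpr ⟨by nlinarith [sq_nonneg (m + 1)], by nlinarith [sq_nonneg m]⟩

lemma isDegree_four_mul_sq : IsDegree fun m : ℤ => 2 * (2 * m ^ 2) :=
  isDegree_of_abs_le (fun m => by positivity)
    fun m => abs_le.mpr ⟨by nlinarith [sq_nonneg (m + 1)], by nlinarith [sq_nonneg (m - 1)]⟩

lemma psiSeries_sq : psiSeries * psiSeries = 2 * dbl psiSeries * phiSeries := by
  rw [mul_assoc, psiSeries, phiSeries, expand_weightedSeries,
    weightedSeries_mul isDegree_pronic isDegree_pronic,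
    weightedSeries_mul isDegree_two_mul_pronic isDegree_two_mul_sq,
    weightedSeries_paritySplit (isDegree_pronic.prod isDegree_pronic), two_mul]
  congr 2 <;> funext p <;> ring

lemma phiSeries_mul_altPhiSeries :
    phiSeries * altPhiSeries = dbl altPhiSeries * dbl altPhiSeries := by
  rw [phiSeries, altPhiSeries, expand_weightedSeries,
    weightedSeries_mul isDegree_two_mul_sq isDegree_two_mul_sq,
    weightedSeries_mul isDegree_four_mul_sq isDegree_four_mul_sq,
    weightedSeries_paritySplit (isDegree_two_mul_sq.prod isDegree_two_mul_sq)]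
  conv_rhs => rw [← add_zero (weightedSeries _ _)]
  congr 1
  · congr 1 <;> funext p
    · ring
    · simp [altSign_sub]
  · refine weightedSeries_eq_zero_of_equiv
      ((Equiv.subLeft (-1 : ℤ)).prodCongr (Equiv.refl ℤ)) (fun p => ?_) fun p => ?_
    · simp
      ring
    · simp [altSign_sub]

lemma jacobiSeries_mul_psiSeries :
    jacobiSeries * psiSeries = 2 * dbl jacobiSeries * altPhiSeries := by
  have hodd : weightedSeries (fun p : ℤ × ℤ => 2 * (p.1 ^ 2 + p.1) + 2 * p.2 ^ 2)
      (fun p => altSign p.1 * altSign p.2 * (2 * p.2)) = 0 :=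
    weightedSeries_eq_zero_of_equiv ((Equiv.refl ℤ).prodCongr (Equiv.neg ℤ))
      (fun p => by simp) fun p => by simp
  have hmain : weightedSeries (fun p : ℤ × ℤ => 2 * (p.1 ^ 2 + p.1) + 2 * p.2 ^ 2)
      (fun p => altSign (p.1 + p.2) * (2 * (p.1 + p.2) + 1)) = dbl jacobiSeries * altPhiSeries := by
    have hadd := weightedSeries_add (isDegree_two_mul_pronic.prod isDegree_two_mul_sq)
      (fun p => altSign p.1 * (2 * p.1 + 1) * altSign p.2)
      (fun p => altSign p.1 * altSign p.2 * (2 * p.2))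
    rw [hodd, add_zero] at hadd
    rw [jacobiSeries, altPhiSeries, expand_weightedSeries,
      weightedSeries_mul isDegree_two_mul_pronic isDegree_two_mul_sq, ← hadd]
    congr 1
    funext p
    rw [altSign_add]
    ring
  rw [mul_assoc, ← hmain, jacobiSeries, psiSeries,
    weightedSeries_mul isDegree_pronic isDegree_pronic,
    weightedSeries_paritySplit (isDegree_pronic.prod isDegree_pronic), two_mul]
  congr 2 <;> funext p <;> ring

lemma coeff_zero_psiSeries : PowerSeries.coeff 0 psiSeries = 2 := by
  rw [psiSeries, coeff_weightedSeries_eq_sum _ _ 0 {0, -1}]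
  · rw [Finset.sum_pair (by decide)]
    simp
  · intro m hm
    have : m * (m + 1) = 0 := by push_cast at hm; linarith
    rcases mul_eq_zero.mp this with h | h <;> simp <;> omega

lemma coeff_zero_jacobiSeries : PowerSeries.coeff 0 jacobiSeries = 2 := by
  rw [jacobiSeries, coeff_weightedSeries_eq_sum _ _ 0 {0, -1}]
  · simp [altSign]
  · intro m hm
    have : m * (m + 1) = 0 := by push_cast at hm; linarith
    rcases mul_eq_zero.mp this with h | h <;> simp <;> omega

lemma coeff_zero_altPhiSeries : PowerSeries.coeff 0 altPhiSeries = 1 := by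
  rw [altPhiSeries, coeff_weightedSeries_eq_sum _ _ 0 {0}]
  · simp [altSign]
  · intro m hm
    simpa using hm

/-- Jacobi's identity for the cube of the eta function, in theta function form. -/
theorem jacobiSeries_eq : jacobiSeries = psiSeries * (altPhiSeries * altPhiSeries) := by
  set D := jacobiSeries - psiSeries * (altPhiSeries * altPhiSeries) with hD
  have h : D * psiSeries = 2 * dbl D * altPhiSeries := by
    rw [hD, map_sub, map_mul, map_mul]
    linear_combination jacobiSeries_mul_psiSeries - altPhiSeries ^ 2 * psiSeries_sq -
      2 * dbl psiSeries * altPhiSeries * phiSeries_mul_altPhiSeries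
  have h0 : PowerSeries.coeff 0 D = 0 := by
    have h1 := coeff_zero_psiSeries
    have h2 := coeff_zero_jacobiSeries
    have h3 := coeff_zero_altPhiSeries
    simp only [PowerSeries.coeff_zero_eq_constantCoeff] at *
    simp [hD, h1, h2, h3]
  by_contra hne
  have hD0 : D ≠ 0 := sub_ne_zero.mpr hne
  have hpsi : psiSeries.order = 0 := by
    rw [← nonpos_iff_eq_zero]
    exact PowerSeries.order_le 0 (by rw [coeff_zero_psiSeries]; decide)
  have hord := congrArg PowerSeries.order h
  rw [PowerSeries.order_mul, PowerSeries.order_mul, PowerSeries.order_mul, hpsi, add_zero,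
    PowerSeries.order_expand] at hord
  have hfin : D.order ≠ ⊤ := PowerSeries.order_eq_top.not.mpr hD0
  have hpos : D.order ≠ 0 := fun h' => PowerSeries.coeff_order hD0 (by simpa [h'] using h0)
  have hle : 2 • D.order ≤ D.order := by
    conv_rhs => rw [hord]
    exact le_add_self.trans le_self_add
  lift D.order to ℕ using hfin with d
  rw [two_nsmul] at hle
  norm_cast at hle hpos
  omega

lemma coeff_jacobiSeries (n : ℕ) :
    ((PowerSeries.coeff (2 * n) jacobiSeries : ℤ) : ℚ) = 2 * sqTerm (8 * n + 1) := by
  have hiff (m : ℤ) : m ^ 2 + m = ((2 * n : ℕ) : ℤ) ↔ (2 * m + 1) ^ 2 = 8 * (n : ℤ) + 1 := by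
    push_cast
    constructor <;> intro h <;> linarith
  rw [sqTerm]
  split_ifs with hsq
  · obtain ⟨s, hs⟩ := hsq
    rw [hs, Nat.sqrt_eq]
    have hodd : Odd s := (Nat.odd_mul.mp (hs.symm ▸ ⟨4 * n, by ring⟩ : Odd (s * s))).1
    obtain ⟨t, rfl⟩ := hodd
    have hs' : (8 * n + 1 : ℤ) = (2 * t + 1) ^ 2 := by
      rw [sq]
      exact_mod_cast hs
    rw [jacobiSeries, coeff_weightedSeries_eq_sum _ _ (2 * n) {(t : ℤ), -1 - (t : ℤ)}]
    · rw [Finset.sum_pair (by omega), if_pos ((hiff _).mpr hs'.symm),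
        if_pos ((hiff _).mpr (by rw [hs']; ring)), altSign_sub, altSign_neg, altSign_one]
      have : altSign t = (-1) ^ t := Int.coe_negOnePow_natCast t
      rw [this, Nat.add_sub_cancel, Nat.mul_div_cancel_left _ two_pos]
      push_cast
      ring
    · intro m hm
      rw [hiff, hs', sq_eq_sq_iff_eq_or_eq_neg] at hm
      rcases hm with h | h <;> simp <;> omega
  · rw [jacobiSeries, coeff_weightedSeries_eq_sum _ _ (2 * n) ∅]
    · simp
    · intro m hm
      rw [hiff] at hm
      refine absurd ⟨(2 * m + 1).natAbs, ?_⟩ hsq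
      zify
      rw [← abs_mul, ← sq, abs_of_nonneg (sq_nonneg _)]
      exact hm.symm

lemma finite_sum_three_sq (k : ℤ) :
    {v : ℤ × ℤ × ℤ | v.1 ^ 2 + v.2.1 ^ 2 + v.2.2 ^ 2 = k}.Finite := by
  refine ((Set.finite_Icc (-k) k).prod ((Set.finite_Icc (-k) k).prod
    (Set.finite_Icc (-k) k))).subset ?_
  rintro ⟨x, y, z⟩ h
  have hle (a : ℤ) : a ≤ a ^ 2 ∧ -a ≤ a ^ 2 := ⟨by nlinarith [Int.le_self_sq a],
    by simpa using Int.le_self_sq (-a)⟩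
  have hx := hle x
  have hy := hle y
  have hz := hle z
  simp only [Set.mem_ofPred_eq, Set.mem_prod, Set.mem_Icc] at h ⊢
  have := sq_nonneg x
  have := sq_nonneg y
  have := sq_nonneg z
  refine ⟨⟨?_, ?_⟩, ⟨?_, ?_⟩, ?_, ?_⟩ <;> linarith

lemma sq_emod_four (a : ℤ) : a % 2 = 0 ∧ a ^ 2 % 4 = 0 ∨ a % 2 = 1 ∧ a ^ 2 % 4 = 1 := by
  rcases Int.even_or_odd' a with ⟨b, rfl | rfl⟩
  · exact .inl ⟨by omega, by ring_nf; omega⟩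
  · exact .inr ⟨by omega, by ring_nf; omega⟩

/-- If `x ^ 2 + y ^ 2 + z ^ 2` is `1` modulo `4`, exactly one of the three numbers is odd, so a
third of the representations have `x` odd. -/
lemma r1_eq_three_mul (n : ℕ) :
    r1 (8 * n + 1) = 3 * {v : ℤ × ℤ × ℤ | v.1 ^ 2 + v.2.1 ^ 2 + v.2.2 ^ 2 = 8 * (n : ℤ) + 1 ∧
      v.1 % 2 = 1}.ncard := by
  set V := (finite_sum_three_sq (8 * n + 1)).toFinset with hV
  have hmem (v : ℤ × ℤ × ℤ) : v ∈ V ↔ v.1 ^ 2 + v.2.1 ^ 2 + v.2.2 ^ 2 = 8 * (n : ℤ) + 1 := by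
    simp [hV]
  have hr : r1 (8 * n + 1) = V.card := by
    rw [r1, ← Set.ncard_coe_finset, ← Nat.card_coe_set_eq]
    congr! 3 with v
    simp [hmem]
  have hx : {v : ℤ × ℤ × ℤ | v.1 ^ 2 + v.2.1 ^ 2 + v.2.2 ^ 2 = 8 * (n : ℤ) + 1 ∧
      v.1 % 2 = 1} = ↑(V.filter fun v => v.1 % 2 = 1) := by
    ext v
    simp [hmem]
  have hy : (V.filter fun v => v.2.1 % 2 = 1).card = (V.filter fun v => v.1 % 2 = 1).card := by
    refine Finset.card_nbij' (fun v => (v.2.1, v.1, v.2.2)) (fun v => (v.2.1, v.1, v.2.2))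
      ?_ ?_ (fun _ _ => rfl) (fun _ _ => rfl) <;>
    · intro v
      simp only [Finset.coe_filter, Set.mem_ofPred_eq, hmem]
      exact fun h => ⟨by linarith [h.1], h.2⟩
  have hz : (V.filter fun v => v.2.2 % 2 = 1).card = (V.filter fun v => v.1 % 2 = 1).card := by
    refine Finset.card_nbij' (fun v => (v.2.2, v.2.1, v.1)) (fun v => (v.2.2, v.2.1, v.1))
      ?_ ?_ (fun _ _ => rfl) (fun _ _ => rfl) <;>
    · intro v
      simp only [Finset.coe_filter, Set.mem_ofPred_eq, hmem]
      exact fun h => ⟨by linarith [h.1], h.2⟩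
  have hsum : V.card = (V.filter fun v => v.1 % 2 = 1).card +
      (V.filter fun v => v.2.1 % 2 = 1).card + (V.filter fun v => v.2.2 % 2 = 1).card := by
    rw [Finset.card_eq_sum_ones, Finset.card_filter, Finset.card_filter, Finset.card_filter,
      ← Finset.sum_add_distrib, ← Finset.sum_add_distrib]
    refine Finset.sum_congr rfl fun v hv => ?_
    rw [hmem] at hv
    have h1 := sq_emod_four v.1
    have h2 := sq_emod_four v.2.1
    have h3 := sq_emod_four v.2.2
    split_ifs <;> omega
  rw [hr, hx, Set.ncard_coe_finset]
  omega

/-- The change of variables `(m, a, b) ↦ (2 m + 1, 2 (a + b), 2 (a - b))`. -/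
def oddEvenEven (p : ℤ × ℤ × ℤ) : ℤ × ℤ × ℤ :=
  (2 * p.1 + 1, 2 * (p.2.1 + p.2.2), 2 * (p.2.1 - p.2.2))

lemma oddEvenEven_injective : Function.Injective oddEvenEven := by
  rintro ⟨m, a, b⟩ ⟨m', a', b'⟩ h
  simp only [oddEvenEven, Prod.mk.injEq] at h ⊢
  omega

lemma exists_oddEvenEven_eq {n : ℕ} {v : ℤ × ℤ × ℤ}
    (hv : v.1 ^ 2 + v.2.1 ^ 2 + v.2.2 ^ 2 = 8 * (n : ℤ) + 1) (hx : v.1 % 2 = 1) :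
    ∃ p, oddEvenEven p = v := by
  obtain ⟨x, y, z⟩ := v
  simp only at hv hx
  have h1 := sq_emod_four x
  have h2 := sq_emod_four y
  have h3 := sq_emod_four z
  obtain ⟨m, rfl⟩ : ∃ m, x = 2 * m + 1 := ⟨x / 2, by omega⟩
  obtain ⟨u, rfl⟩ : ∃ u, y = 2 * u := ⟨y / 2, by omega⟩
  obtain ⟨w, rfl⟩ : ∃ w, z = 2 * w := ⟨z / 2, by omega⟩
  have hm : m ^ 2 + m + u ^ 2 + w ^ 2 = 2 * n := by linarith
  have h4 := Int.even_iff.mp (Int.even_mul_succ_self m)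
  rw [show m * (m + 1) = m ^ 2 + m by ring] at h4
  have h5 := sq_emod_four u
  have h6 := sq_emod_four w
  refine ⟨(m, (u + w) / 2, (u - w) / 2), ?_⟩
  simp only [oddEvenEven, Prod.mk.injEq, true_and]
  omega

lemma oddEvenEven_sum_sq (p : ℤ × ℤ × ℤ) (n : ℕ) :
    (oddEvenEven p).1 ^ 2 + (oddEvenEven p).2.1 ^ 2 + (oddEvenEven p).2.2 ^ 2 = 8 * (n : ℤ) + 1 ↔
      p.1 ^ 2 + p.1 + (2 * p.2.1 ^ 2 + 2 * p.2.2 ^ 2) = ((2 * n : ℕ) : ℤ) := by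
  simp only [oddEvenEven]
  push_cast
  constructor <;> intro h <;> linarith

lemma altSign_eq (a : ℤ) : altSign a = 1 - 2 * if a % 2 = 1 then 1 else 0 := by
  split_ifs with h
  · simp [altSign, Int.negOnePow_odd _ (Int.odd_iff.mpr h)]
  · have h' : Even a := Int.even_iff.mpr (by omega)
    simp [altSign, Int.negOnePow_even _ h']

theorem stmt_18 (n : ℕ) (hn : 0 < n) :
    (Nat.card {v : ℤ × ℤ × ℤ //
        v.1 ^ 2 + v.2.1 ^ 2 + v.2.2 ^ 2 = 8 * (n : ℤ) + 1 ∧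
        v.1 ≡ 1 [ZMOD 2] ∧ v.2.1 ≡ 2 [ZMOD 4] ∧ v.2.2 ≡ 2 [ZMOD 4]} : ℚ) =
      (1 / 6 : ℚ) * r1 (8 * n + 1) - sqTerm (8 * n + 1) := by
  have hdeg := isDegree_pronic.prod (isDegree_two_mul_sq.prod isDegree_two_mul_sq)
  set T := ((hdeg.finite (2 * n : ℕ)).subset fun p hp => le_of_eq hp :
    {p : ℤ × ℤ × ℤ | p.1 ^ 2 + p.1 + (2 * p.2.1 ^ 2 + 2 * p.2.2 ^ 2) =
      ((2 * n : ℕ) : ℤ)}.Finite).toFinset with hT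
  have hmem (p : ℤ × ℤ × ℤ) : p ∈ T ↔ p.1 ^ 2 + p.1 + (2 * p.2.1 ^ 2 + 2 * p.2.2 ^ 2) =
      ((2 * n : ℕ) : ℤ) := by
    simp [hT]
  have hO : {v : ℤ × ℤ × ℤ | v.1 ^ 2 + v.2.1 ^ 2 + v.2.2 ^ 2 = 8 * (n : ℤ) + 1 ∧
      v.1 % 2 = 1} = oddEvenEven '' T := by
    ext v
    simp only [Set.mem_ofPred_eq, Set.mem_image, Finset.mem_coe, hmem]
    constructor
    · rintro ⟨hv, hx⟩
      obtain ⟨p, rfl⟩ := exists_oddEvenEven_eq hv hx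
      exact ⟨p, (oddEvenEven_sum_sq p n).mp hv, rfl⟩
    · rintro ⟨p, hp, rfl⟩
      refine ⟨(oddEvenEven_sum_sq p n).mpr hp, ?_⟩
      simp only [oddEvenEven]
      omega
  have hA : {v : ℤ × ℤ × ℤ | v.1 ^ 2 + v.2.1 ^ 2 + v.2.2 ^ 2 = 8 * (n : ℤ) + 1 ∧
      v.1 ≡ 1 [ZMOD 2] ∧ v.2.1 ≡ 2 [ZMOD 4] ∧ v.2.2 ≡ 2 [ZMOD 4]} =
      oddEvenEven '' (T.filter fun p => (p.2.1 + p.2.2) % 2 = 1) := by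
    ext v
    simp only [Set.mem_ofPred_eq, Set.mem_image, Finset.mem_coe, Finset.mem_filter, hmem, Int.ModEq]
    constructor
    · rintro ⟨hv, hx, hy, hz⟩
      obtain ⟨p, rfl⟩ := exists_oddEvenEven_eq hv hx
      refine ⟨p, ⟨(oddEvenEven_sum_sq p n).mp hv, ?_⟩, rfl⟩
      simp only [oddEvenEven] at hy
      omega
    · rintro ⟨p, ⟨hp, hodd⟩, rfl⟩
      refine ⟨(oddEvenEven_sum_sq p n).mpr hp, ?_⟩
      simp only [oddEvenEven]
      omega
  have hcoeff : PowerSeries.coeff (2 * n) jacobiSeries =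
      T.card - 2 * (T.filter fun p => (p.2.1 + p.2.2) % 2 = 1).card := by
    rw [jacobiSeries_eq, psiSeries, altPhiSeries,
      weightedSeries_mul isDegree_two_mul_sq isDegree_two_mul_sq,
      weightedSeries_mul isDegree_pronic (isDegree_two_mul_sq.prod isDegree_two_mul_sq),
      coeff_weightedSeries_eq_sum _ _ (2 * n) T fun p hp => (hmem p).mpr hp,
      Finset.card_eq_sum_ones, Finset.card_filter]
    push_cast
    rw [Finset.mul_sum, ← Finset.sum_sub_distrib]
    refine Finset.sum_congr rfl fun p hp => ?_
    rw [if_pos (by exact_mod_cast (hmem p).mp hp), one_mul, ← altSign_add, altSign_eq]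
  have hcardA := congrArg Set.ncard hA
  have hr := r1_eq_three_mul n
  rw [Set.ncard_image_of_injective _ oddEvenEven_injective, Set.ncard_coe_finset] at hcardA
  rw [hO, Set.ncard_image_of_injective _ oddEvenEven_injective, Set.ncard_coe_finset] at hr
  have hj := coeff_jacobiSeries n
  rw [hcoeff] at hj
  have hcard := (Nat.card_coe_set_eq _).trans hcardA
  rw [hr]
  refine (congrArg (Nat.cast : ℕ → ℚ) hcard).trans ?_
  push_cast at hj ⊢
  linarith
end

section
/- Let n be a positive integer. Then the number of (x,y,z) ∈ ℤ³ with x²+y²+2z² = 16n+2, x ≡ 1 (mod 2), y ≡ 1 (mod 2), and z ≡ 2 (mod 4) equals (1/3)·𝔯₁(8n+1) − δ_□(8n+1)·(−1)^((√(8n+1)−1)/2)·2√(8n+1). Moreover, the number of (x,y,z) ∈ ℤ³ with x²+y²+2z² = 16n+10 and the same congruence conditions equals (1/3)·𝔯₁(8n+5). -/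
/-- Gaussian binomial coefficients with base `b`. -/
def gaussBinom {A : Type*} [CommRing A] (b : A) : ℕ → ℕ → A
  | _, 0 => 1
  | 0, _ + 1 => 0
  | n + 1, k + 1 => gaussBinom b n k + b ^ (k + 1) * gaussBinom b n (k + 1)

section JacobiTripleProduct

open Polynomial Finset

variable {A : Type*} [CommRing A]

@[simp] theorem gaussBinom_zero_right (b : A) (n : ℕ) : gaussBinom b n 0 = 1 := by
  cases n <;> rfl

theorem gaussBinom_succ_succ (b : A) (n k : ℕ) :
    gaussBinom b (n + 1) (k + 1) = gaussBinom b n k + b ^ (k + 1) * gaussBinom b n (k + 1) :=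
  rfl

theorem gaussBinom_eq_zero_of_lt (b : A) {n k : ℕ} (h : n < k) : gaussBinom b n k = 0 := by
  induction n generalizing k with
  | zero => obtain ⟨k, rfl⟩ : ∃ j, k = j + 1 := ⟨k - 1, by omega⟩; rfl
  | succ n ih =>
    obtain ⟨k, rfl⟩ : ∃ j, k = j + 1 := ⟨k - 1, by omega⟩
    rw [gaussBinom_succ_succ, ih (by omega), ih (by omega)]
    simp

theorem gaussBinom_self (b : A) (n : ℕ) : gaussBinom b n n = 1 := by
  induction n with
  | zero => rfl
  | succ n ih => rw [gaussBinom_succ_succ, ih, gaussBinom_eq_zero_of_lt b n.lt_succ_self]; simp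

theorem gaussBinom_succ_succ' (b : A) (k l : ℕ) :
    gaussBinom b (k + l + 1) (k + 1) =
      b ^ l * gaussBinom b (k + l) k + gaussBinom b (k + l) (k + 1) := by
  induction hn : k + l generalizing k l with
  | zero =>
    obtain ⟨rfl, rfl⟩ : k = 0 ∧ l = 0 := by omega
    simp [gaussBinom]
  | succ n ih =>
    rcases l with _ | l
    · obtain rfl : k = n + 1 := by omega
      simp [gaussBinom_self, gaussBinom_eq_zero_of_lt]
    rcases k with _ | k
    · have := ih 0 l (by omega)
      have h3 := gaussBinom_succ_succ b n 0
      rw [gaussBinom_succ_succ]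
      simp only [gaussBinom_zero_right] at *
      linear_combination b * this - h3
    · have h1 := ih k (l + 1) (by omega)
      have h2 := ih (k + 1) l (by omega)
      have h3 := gaussBinom_succ_succ b n k
      have h4 := gaussBinom_succ_succ b n (k + 1)
      rw [gaussBinom_succ_succ]
      linear_combination h1 + b ^ (k + 2) * h2 - b ^ (l + 1) * h3 - h4

/-- The finite product `∏_{i=1}^{n} (1 - b ^ i)`. -/
def qProd (b : A) (n : ℕ) : A := ∏ i ∈ range n, (1 - b ^ (i + 1))

theorem qProd_succ (b : A) (n : ℕ) : qProd b (n + 1) = qProd b n * (1 - b ^ (n + 1)) :=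
  prod_range_succ _ _

theorem gaussBinom_mul_qProd (b : A) (k l : ℕ) :
    gaussBinom b (k + l) k * (qProd b k * qProd b l) = qProd b (k + l) := by
  induction hn : k + l generalizing k l with
  | zero =>
    obtain ⟨rfl, rfl⟩ : k = 0 ∧ l = 0 := by omega
    simp [qProd]
  | succ n ih =>
    rcases l with _ | l
    · obtain rfl : k = n + 1 := by omega
      simp [gaussBinom_self, qProd]
    rcases k with _ | k
    · obtain rfl : l = n := by omega
      simp [qProd]
    · have h1 := ih k (l + 1) (by omega)
      have h2 := ih (k + 1) l (by omega)
      obtain rfl : n = k + l + 1 := by omega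
      rw [gaussBinom_succ_succ]
      simp only [qProd_succ] at *
      linear_combination (1 - b ^ (k + 1)) * h1 + b ^ (k + 1) * (1 - b ^ (l + 1)) * h2

/-- The finite product in the finite form of the Jacobi triple product. -/
noncomputable def tripleProd (q : A) (β γ δ m n : ℕ) : A[X] :=
  (∏ i ∈ range m, (1 + C (q ^ (γ + β * i)) * X)) * ∏ i ∈ range n, (X + C (q ^ (δ + β * i)))

/-- The finite form of the Jacobi triple product identity. -/
theorem coeff_tripleProd (q : A) {β γ δ : ℕ} (hβ : γ + δ = β) {e : ℤ → ℕ} (h0 : e 0 = 0)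
    (he : ∀ j : ℤ, (e (j + 1) : ℤ) = e j + γ + β * j) (m n k : ℕ) :
    (tripleProd q β γ δ m n).coeff k =
      q ^ e ((k : ℤ) - n) * gaussBinom (q ^ β) (m + n) k := by
  induction m generalizing k with
  | zero =>
    induction n generalizing k with
    | zero =>
      rcases k with _ | k
      · simp [tripleProd, h0]
      · simp [tripleProd, gaussBinom, coeff_one]
    | succ n ih =>
      have : tripleProd q β γ δ 0 (n + 1) =
          tripleProd q β γ δ 0 n * X + tripleProd q β γ δ 0 n * C (q ^ (δ + β * n)) := by
        rw [tripleProd, prod_range_succ, tripleProd]; ring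
      rw [this, coeff_add, coeff_mul_C, ih]
      rcases k with _ | k
      · simp only [coeff_mul_X_zero, gaussBinom_zero_right, zero_add, mul_one, ← pow_add]
        congr 1
        have := he (-n - 1)
        rw [show (-n - 1 + 1 : ℤ) = ((0 : ℕ) : ℤ) - n by simp,
          show (-n - 1 : ℤ) = ((0 : ℕ) : ℤ) - (n + 1 : ℕ) by push_cast; ring] at this
        zify at hβ ⊢
        push_cast at this ⊢
        linear_combination this + hβ
      · rw [coeff_mul_X, ih]
        simp only [zero_add, gaussBinom_succ_succ]
        have h1 : ((k + 1 : ℕ) : ℤ) - (n + 1 : ℕ) = k - n := by push_cast; ring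
        have h2 : q ^ e (((k + 1 : ℕ) : ℤ) - n) * q ^ (δ + β * n) =
            q ^ e ((k : ℤ) - n) * (q ^ β) ^ (k + 1) := by
          rw [← pow_mul, ← pow_add, ← pow_add]
          congr 1
          have := he (k - n)
          rw [show (k : ℤ) - n + 1 = (k : ℤ) + 1 - n by ring] at this
          zify
          rw [this]
          subst hβ
          push_cast
          ring
        rw [h1]
        linear_combination gaussBinom (q ^ β) n (k + 1) * h2
  | succ m ih =>
    have : tripleProd q β γ δ (m + 1) n =
        tripleProd q β γ δ m n + tripleProd q β γ δ m n * X * C (q ^ (γ + β * m)) := by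
      rw [tripleProd, prod_range_succ, tripleProd]; ring
    rw [this, coeff_add, coeff_mul_C, ih]
    rcases k with _ | k
    · simp
    · rw [coeff_mul_X, ih]
      rcases le_or_gt k (m + n) with hk | hk
      · obtain ⟨l, hl⟩ := Nat.exists_eq_add_of_le hk
        have hp := gaussBinom_succ_succ' (q ^ β) k l
        rw [← hl] at hp
        rw [show m + 1 + n = m + n + 1 by ring, hp]
        have h2 : q ^ e ((k : ℤ) - n) * q ^ (γ + β * m) =
            q ^ e (((k + 1 : ℕ) : ℤ) - n) * (q ^ β) ^ l := by
          rw [← pow_mul, ← pow_add, ← pow_add]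
          congr 1
          have := he (k - n)
          rw [show (k : ℤ) - n + 1 = (k : ℤ) + 1 - n by ring] at this
          zify at hl ⊢
          rw [this]
          linear_combination (β : ℤ) * hl
        linear_combination gaussBinom (q ^ β) (m + n) k * h2
      · rw [gaussBinom_eq_zero_of_lt _ hk, gaussBinom_eq_zero_of_lt _ (by omega),
          gaussBinom_eq_zero_of_lt _ (by omega)]
        simp

theorem tripleProd_eq_sum (q : A) {β γ δ : ℕ} (hβ : γ + δ = β) {e : ℤ → ℕ} (h0 : e 0 = 0)
    (he : ∀ j : ℤ, (e (j + 1) : ℤ) = e j + γ + β * j) (m n : ℕ) :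
    tripleProd q β γ δ m n = ∑ k ∈ range (m + n + 1),
      C (q ^ e ((k : ℤ) - n) * gaussBinom (q ^ β) (m + n) k) * X ^ k := by
  ext k
  rw [coeff_tripleProd q hβ h0 he, finsetSum_coeff]
  simp only [coeff_C_mul_X_pow]
  rw [sum_ite_eq]
  split_ifs with h
  · rfl
  · rw [gaussBinom_eq_zero_of_lt _ (by simpa using h), mul_zero]

theorem qProd_of_le {b : A} {N : ℕ} (hb : b ^ N = 0) {n : ℕ} (hn : N ≤ n) :
    qProd b n = qProd b N := by
  induction n, hn using Nat.le_induction with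
  | base => rfl
  | succ n hn ih => rw [qProd_succ, ih, pow_eq_zero_of_le (by omega) hb]; simp

theorem isUnit_qProd {b : A} (hb : IsNilpotent b) (n : ℕ) : IsUnit (qProd b n) :=
  prod_induction _ IsUnit (fun _ _ => IsUnit.mul) isUnit_one
    fun i _ => (hb.pow_succ i).isUnit_one_sub

theorem qProd_mul_gaussBinom {b : A} {N : ℕ} (hb : b ^ N = 0) {k l : ℕ} (hk : N ≤ k)
    (hl : N ≤ l) : qProd b N * gaussBinom b (k + l) k = 1 := by
  have h := gaussBinom_mul_qProd b k l
  rw [qProd_of_le hb hk, qProd_of_le hb hl, qProd_of_le hb (by omega : N ≤ k + l)] at h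
  apply (isUnit_qProd ⟨N, hb⟩ N).mul_left_cancel
  linear_combination h

theorem negOnePow_natCast_sub (k n : ℕ) :
    (((((k : ℤ) - n).negOnePow : ℤˣ) : ℤ) : A) = (-1) ^ n * (-1) ^ k := by
  rw [Int.negOnePow_sub]
  simp [mul_comm]

theorem qProd_mul_sum {q : A} {N : ℕ} (hq : q ^ N = 0) {β : ℕ} (hβ : β ≠ 0) {e : ℤ → ℕ}
    (he : ∀ j : ℤ, e j < N → |j| ≤ N) {m n : ℕ} (hm : 2 * N ≤ m) (hn : 2 * N ≤ n) (f : ℤ → A) :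
    qProd (q ^ β) N * ∑ k ∈ range (m + n + 1),
        q ^ e ((k : ℤ) - n) * gaussBinom (q ^ β) (m + n) k * f (k - n) =
      ∑ j ∈ Icc (-n : ℤ) m, f j * q ^ e j := by
  have hb : (q ^ β) ^ N = 0 := by rw [← pow_mul, mul_comm, pow_mul, hq, zero_pow hβ]
  rw [mul_sum]
  refine sum_nbij' (fun k => (k : ℤ) - n) (fun j => (j + n).toNat) ?_ ?_ ?_ ?_ ?_
  · intro k hk; simp at hk ⊢; omega
  · intro k hk; simp at hk ⊢; omega
  · intro k hk; simp
  · intro j hj; simp at hj ⊢; omega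
  · intro k hk
    simp only [mem_range] at hk
    by_cases h : e ((k : ℤ) - n) < N
    · have h1 := abs_le.mp (he _ h)
      have h2 := qProd_mul_gaussBinom hb (k := k) (l := m + n - k) (by omega) (by omega)
      rw [show k + (m + n - k) = m + n by omega] at h2
      linear_combination q ^ e ((k : ℤ) - n) * f (k - n) * h2
    · rw [pow_eq_zero_of_le (not_lt.mp h) hq]; simp

/-- Triangular numbers, indexed by the integers. -/
def triangular (j : ℤ) : ℕ := (j * (j + 1) / 2).toNat

theorem two_mul_triangular (j : ℤ) : 2 * (triangular j : ℤ) = j * (j + 1) := by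
  have h1 : 0 ≤ j * (j + 1) := by
    rcases le_or_gt 0 j with h | h <;> nlinarith
  have h2 := Int.even_mul_succ_self j
  rw [triangular, Int.toNat_of_nonneg (by positivity), Int.mul_ediv_cancel' h2.two_dvd]

theorem triangular_succ (j : ℤ) :
    (triangular (j + 1) : ℤ) = triangular j + (1 : ℕ) + (1 : ℕ) * j := by
  have h1 := two_mul_triangular j
  have h2 := two_mul_triangular (j + 1)
  push_cast
  linarith

theorem abs_le_of_triangular_lt {j : ℤ} {N : ℕ} (h : triangular j < N) : |j| ≤ N := by
  have h1 := two_mul_triangular j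
  zify at h
  rw [abs_le]
  constructor <;> nlinarith

theorem natAbs_sq_succ (j : ℤ) :
    (((j + 1).natAbs ^ 2 : ℕ) : ℤ) = (j.natAbs ^ 2 : ℕ) + (1 : ℕ) + (2 : ℕ) * j := by
  push_cast
  simp only [sq_abs]
  ring

theorem abs_le_of_natAbs_sq_lt {j : ℤ} {N : ℕ} (h : j.natAbs ^ 2 < N) : |j| ≤ N := by
  have : j.natAbs ≤ N := by nlinarith
  rw [Int.abs_eq_natAbs]
  exact_mod_cast this

/-- The finite product `∏_{i=1}^{n} (1 - q ^ (2 i - 1))`. -/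
def oddProd (q : A) (n : ℕ) : A := ∏ i ∈ range n, (1 - q ^ (1 + 2 * i))

/-- The finite product `∏_{i=1}^{n} (1 + q ^ i)`. -/
def plusProd (q : A) (n : ℕ) : A := ∏ i ∈ range n, (1 + q ^ (i + 1))

theorem prod_range_two_mul_neg (f : ℕ → A) (n : ℕ) :
    ∏ i ∈ range (2 * n), -f i = ∏ i ∈ range (2 * n), f i := by
  rw [prod_neg]
  simp

theorem sum_negOnePow_mul_pow_sq {q : A} {N : ℕ} (hq : q ^ N = 0) :
    ∑ j ∈ Icc (-(2 * N : ℕ) : ℤ) (2 * N : ℕ), ((j.negOnePow : ℤˣ) : A) * q ^ (j.natAbs ^ 2) =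
      qProd (q ^ 2) N * oddProd q (2 * N) ^ 2 := by
  have h := congr_arg (eval (-1)) (tripleProd_eq_sum q (β := 2) (γ := 1) (δ := 1) rfl
    (e := fun j => j.natAbs ^ 2) rfl natAbs_sq_succ (2 * N) (2 * N))
  rw [← qProd_mul_sum hq two_ne_zero (fun _ => abs_le_of_natAbs_sq_lt) le_rfl le_rfl]
  congr 1
  simp only [eval_finsetSum, eval_mul, eval_C, eval_pow, eval_X] at h
  simp only [negOnePow_natCast_sub, (even_two_mul N).neg_one_pow, one_mul, ← h]
  simp only [tripleProd, eval_mul, eval_prod, eval_add, eval_one, eval_C, eval_X, sq, oddProd]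
  congr 1
  · exact prod_congr rfl fun i _ => by ring
  · rw [← prod_range_two_mul_neg]
    exact prod_congr rfl fun i _ => by ring

theorem plusProd_of_le {q : A} {N : ℕ} (hq : q ^ N = 0) {n : ℕ} (hn : N ≤ n) :
    plusProd q n = plusProd q N := by
  induction n, hn using Nat.le_induction with
  | base => rfl
  | succ n hn ih =>
    rw [plusProd, prod_range_succ, ← plusProd, ih, pow_eq_zero_of_le (by omega) hq]; simp

theorem sum_pow_triangular {q : A} {N : ℕ} (hN : N ≠ 0) (hq : q ^ N = 0) :
    ∑ j ∈ Icc (-(2 * N : ℕ) : ℤ) (2 * N : ℕ), q ^ triangular j =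
      2 * qProd q N * plusProd q N ^ 2 := by
  have h := congr_arg (eval 1) (tripleProd_eq_sum q (β := 1) (γ := 1) (δ := 0) rfl
    (e := triangular) rfl triangular_succ (2 * N) (2 * N))
  have h2 := qProd_mul_sum hq one_ne_zero (fun _ => abs_le_of_triangular_lt)
    (le_refl (2 * N)) (le_refl (2 * N)) fun _ => 1
  simp only [eval_finsetSum, eval_mul, eval_C, eval_pow, eval_X, one_pow] at h
  simp only [one_mul] at h2
  rw [← h2, ← h]
  have h3 : ∏ i ∈ range (2 * N), (1 + q ^ i) = 2 * plusProd q N := by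
    obtain ⟨M, hM⟩ : ∃ M, 2 * N = M + 1 := ⟨2 * N - 1, by omega⟩
    rw [hM, prod_range_succ', ← plusProd, plusProd_of_le hq (by omega)]
    norm_num
    ring
  have h4 : ∏ i ∈ range (2 * N), (1 + q ^ (i + 1)) = plusProd q N :=
    plusProd_of_le hq (by omega)
  simp only [tripleProd, eval_mul, eval_prod, eval_add, eval_one, eval_C, eval_X, zero_add,
    one_mul, mul_one, add_comm 1, h4]
  simp only [h3, pow_one]
  ring

theorem sum_negOnePow_mul_self_mul_pow_triangular {q : A} {N : ℕ} (hq : q ^ N = 0) :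
    ∑ j ∈ Icc (-(2 * N + 1 : ℕ) : ℤ) (2 * N : ℕ),
        ((j.negOnePow : ℤˣ) : A) * (j : A) * q ^ triangular j = qProd q N ^ 3 := by
  have hE := tripleProd_eq_sum q (β := 1) (γ := 1) (δ := 0) rfl
    (e := triangular) rfl triangular_succ (2 * N) (2 * N + 1)
  have hP : tripleProd q 1 1 0 (2 * N) (2 * N + 1) =
      tripleProd q 1 1 1 (2 * N) (2 * N) * (X + 1) := by
    simp only [tripleProd]
    rw [prod_range_succ' _ (2 * N)]
    rw [mul_assoc]
    congr 2
    · exact prod_congr rfl fun i _ => by ring_nf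
    · simp
  have h0 : eval (-1) (tripleProd q 1 1 0 (2 * N) (2 * N + 1)) = 0 := by simp [hP]
  have h1 : eval (-1) (derivative (tripleProd q 1 1 0 (2 * N) (2 * N + 1))) =
      qProd q N ^ 2 := by
    rw [hP]
    simp only [derivative_mul, eval_add, eval_mul, derivative_add, derivative_X, derivative_one,
      eval_X, eval_one, neg_add_cancel, mul_zero, zero_add, add_zero, mul_one]
    simp only [tripleProd, eval_mul, eval_prod, eval_add, eval_one, eval_C, eval_X, sq]
    rw [← qProd_of_le hq (by omega : N ≤ 2 * N)]
    congr 1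
    · exact prod_congr rfl fun i _ => by ring
    · rw [qProd, ← prod_range_two_mul_neg]
      exact prod_congr rfl fun i _ => by ring
  rw [hE] at h0 h1
  simp only [eval_finsetSum, eval_mul, eval_C, eval_pow, eval_X, derivative_sum,
    derivative_C_mul_X_pow] at h0 h1
  have h2 := qProd_mul_sum hq one_ne_zero (fun _ => abs_le_of_triangular_lt)
    (le_refl (2 * N)) (by omega : 2 * N ≤ 2 * N + 1) fun j => ((j.negOnePow : ℤˣ) : A) * (j : A)
  rw [← h2, pow_one, pow_succ' (qProd q N), ← h1]
  congr 1
  refine Eq.trans ?_ (add_zero _)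
  rw [← mul_zero (2 * N + 1 : A), ← h0, mul_sum, ← sum_add_distrib]
  refine sum_congr rfl fun k _ => ?_
  rw [negOnePow_natCast_sub, pow_succ (-1 : A) (2 * N), (even_two_mul N).neg_one_pow]
  rcases k with _ | k
  · simp
    ring
  · simp only [Nat.add_sub_cancel, pow_one]
    push_cast
    ring

theorem qProd_sq_eq (q : A) (n : ℕ) : qProd (q ^ 2) n = qProd q n * plusProd q n := by
  rw [qProd, qProd, plusProd, ← prod_mul_distrib]
  exact prod_congr rfl fun i _ => by ring

theorem qProd_two_mul (q : A) (n : ℕ) : qProd q (2 * n) = oddProd q n * qProd (q ^ 2) n := by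
  induction n with
  | zero => simp [qProd, oddProd]
  | succ n ih =>
    rw [mul_add_one, qProd_succ, qProd_succ, ih, qProd_succ, oddProd, oddProd, prod_range_succ]
    ring

theorem theta_identity {q : A} {N : ℕ} (hN : N ≠ 0) (hq : q ^ N = 0) :
    (∑ j ∈ Icc (-(2 * N : ℕ) : ℤ) (2 * N : ℕ), ((j.negOnePow : ℤˣ) : A) * q ^ (j.natAbs ^ 2)) ^ 2 *
        ∑ j ∈ Icc (-(2 * N : ℕ) : ℤ) (2 * N : ℕ), q ^ triangular j =
      2 * ∑ j ∈ Icc (-(2 * N + 1 : ℕ) : ℤ) (2 * N : ℕ),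
        ((j.negOnePow : ℤˣ) : A) * (j : A) * q ^ triangular j := by
  rw [sum_negOnePow_mul_pow_sq hq, sum_pow_triangular hN hq,
    sum_negOnePow_mul_self_mul_pow_triangular hq]
  have h1 := qProd_two_mul q (2 * N)
  have hq2 : (q ^ 2) ^ N = 0 := by rw [← pow_mul, mul_comm, pow_mul, hq, zero_pow two_ne_zero]
  rw [qProd_of_le hq (by omega), qProd_of_le hq2 (by omega), qProd_sq_eq] at h1
  rw [qProd_sq_eq]
  have h2 : oddProd q (2 * N) * plusProd q N = 1 := by
    apply (isUnit_qProd ⟨N, hq⟩ N).mul_left_cancel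
    linear_combination -h1
  calc _ = 2 * (oddProd q (2 * N) * plusProd q N) ^ 4 * qProd q N ^ 3 := by ring
    _ = _ := by rw [h2]; ring

theorem coeff_theta_identity (n : ℕ) :
    ∑ a ∈ Icc (-(2 * (n + 1) : ℕ) : ℤ) (2 * (n + 1) : ℕ),
      ∑ b ∈ Icc (-(2 * (n + 1) : ℕ) : ℤ) (2 * (n + 1) : ℕ),
        ∑ j ∈ Icc (-(2 * (n + 1) : ℕ) : ℤ) (2 * (n + 1) : ℕ),
          (if a.natAbs ^ 2 + b.natAbs ^ 2 + triangular j = n then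
            (((a + b).negOnePow : ℤˣ) : ℤ) else 0) =
      2 * ∑ j ∈ Icc (-(2 * (n + 1) + 1 : ℕ) : ℤ) (2 * (n + 1) : ℕ),
        if triangular j = n then ((j.negOnePow : ℤˣ) : ℤ) * j else 0 := by
  let I : Ideal ℤ[X] := Ideal.span {X ^ (n + 1)}
  have hq : (Ideal.Quotient.mk I X) ^ (n + 1) = 0 := by
    rw [← map_pow, Ideal.Quotient.eq_zero_iff_mem]
    exact Ideal.mem_span_singleton_self _
  have h := theta_identity n.succ_ne_zero hq
  have hmk (p : ℤ → ℤ) (e : ℤ → ℕ) (s : Finset ℤ) :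
      ∑ j ∈ s, (p j : ℤ[X] ⧸ I) * Ideal.Quotient.mk I X ^ e j =
        Ideal.Quotient.mk I (∑ j ∈ s, C (p j) * X ^ e j) := by
    simp
  have h1 := hmk (fun j => ((j.negOnePow : ℤˣ) : ℤ)) (fun j => j.natAbs ^ 2)
  have h2 := hmk (fun _ => 1) triangular
  have h3 := hmk (fun j => ((j.negOnePow : ℤˣ) : ℤ) * j) triangular
  simp only [Int.cast_one, one_mul, map_one] at h2
  simp only [Int.cast_mul] at h3
  rw [h1, h2, h3, ← map_ofNat (Ideal.Quotient.mk I) 2, ← map_pow, ← map_mul, ← map_mul,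
    Ideal.Quotient.eq, Ideal.mem_span_singleton, X_pow_dvd_iff] at h
  have h4 := h n n.lt_succ_self
  rw [coeff_sub, sub_eq_zero] at h4
  convert h4 using 1
  · rw [sq, sum_mul_sum, sum_mul, finsetSum_coeff]
    refine sum_congr rfl fun a _ => ?_
    rw [sum_mul, finsetSum_coeff]
    refine sum_congr rfl fun b _ => ?_
    rw [mul_sum, finsetSum_coeff]
    refine sum_congr rfl fun j _ => ?_
    have : C (((a.negOnePow : ℤˣ) : ℤ)) * X ^ (a.natAbs ^ 2) *
        (C (((b.negOnePow : ℤˣ) : ℤ)) * X ^ (b.natAbs ^ 2)) * X ^ triangular j =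
        C ((((a + b).negOnePow : ℤˣ) : ℤ)) *
          X ^ (a.natAbs ^ 2 + b.natAbs ^ 2 + triangular j) := by
      rw [Int.negOnePow_add, Units.val_mul, C_mul]
      ring
    rw [this, coeff_C_mul_X_pow]
    simp only [eq_comm]
  · rw [coeff_ofNat_mul, finsetSum_coeff]
    simp only [coeff_C_mul_X_pow, eq_comm]

end JacobiTripleProduct

section Counting

open Finset

theorem triangular_eq_iff (j : ℤ) (n : ℕ) :
    triangular j = n ↔ (2 * j + 1) ^ 2 = 8 * (n : ℤ) + 1 := by
  have h := two_mul_triangular j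
  zify
  constructor <;> intro h' <;> linarith

theorem sum_triangular_eq_sqTerm (n : ℕ) :
    ((∑ j ∈ Icc (-(2 * (n + 1) + 1 : ℕ) : ℤ) (2 * (n + 1) : ℕ),
      if triangular j = n then ((j.negOnePow : ℤˣ) : ℤ) * j else 0 : ℤ) : ℚ) =
      sqTerm (8 * n + 1) := by
  rw [← sum_filter, sqTerm]
  split_ifs with hs
  · obtain ⟨s, hs⟩ := hs
    have hodd : s % 2 = 1 := by
      rcases Nat.mod_two_eq_zero_or_one s with h | h
      · obtain ⟨t, rfl⟩ := Nat.dvd_of_mod_eq_zero h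
        have : 2 * t * (2 * t) = 2 * (t * (2 * t)) := by ring
        omega
      · exact h
    obtain ⟨h, rfl⟩ : ∃ h, s = 2 * h + 1 := ⟨s / 2, by omega⟩
    rw [hs, Nat.sqrt_eq, Nat.add_sub_cancel, Nat.mul_div_cancel_left _ two_pos]
    have hset : (Icc (-(2 * (n + 1) + 1 : ℕ) : ℤ) (2 * (n + 1) : ℕ)).filter
        (fun j => triangular j = n) = {(h : ℤ), -1 - (h : ℤ)} := by
      ext j
      simp only [mem_filter, mem_Icc, triangular_eq_iff, mem_insert, mem_singleton]
      have hs' : 8 * (n : ℤ) + 1 = (2 * h + 1) ^ 2 := by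
        zify at hs; rw [hs]; ring
      constructor
      · rintro ⟨-, hj⟩
        rw [hs', sq_eq_sq_iff_eq_or_eq_neg] at hj
        omega
      · have : (h : ℤ) ≤ n := by
          rcases Nat.eq_zero_or_pos h with rfl | h0
          · simp
          · zify at h0; nlinarith
        rintro (rfl | rfl)
        · refine ⟨⟨by omega, by omega⟩, hs'.symm⟩
        · refine ⟨⟨by omega, by omega⟩, ?_⟩
          rw [hs']; ring
    rw [hset, sum_pair (by omega)]
    have h1 : (((h : ℤ).negOnePow : ℤˣ) : ℤ) = (-1) ^ h := Int.coe_negOnePow_natCast h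
    have h2 : (((-1 - (h : ℤ)).negOnePow : ℤˣ) : ℤ) = -(-1) ^ h := by
      rw [Int.negOnePow_sub, Units.val_mul, h1]
      simp
    rw [h1, h2]
    push_cast
    ring
  · rw [Finset.filter_false_of_mem]
    · simp
    · intro j _ hj
      rw [triangular_eq_iff] at hj
      refine hs ⟨(2 * j + 1).natAbs, ?_⟩
      zify
      rw [← hj, ← sq, sq_abs]

/-- The representations of `m` as a sum of three squares. -/
noncomputable def threeSquares (m : ℕ) : Finset (ℤ × ℤ × ℤ) :=
  (Icc (-m : ℤ) m ×ˢ Icc (-m : ℤ) m ×ˢ Icc (-m : ℤ) m).filter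
    fun v => v.1 ^ 2 + v.2.1 ^ 2 + v.2.2 ^ 2 = m

theorem neg_le_and_le_of_sq_le {x : ℤ} {m : ℕ} (h : x ^ 2 ≤ m) : -(m : ℤ) ≤ x ∧ x ≤ m := by
  have h1 := Int.le_self_sq x
  have h2 := Int.le_self_sq (-x)
  rw [neg_sq] at h2
  constructor <;> linarith

theorem mem_threeSquares {m : ℕ} {v : ℤ × ℤ × ℤ} :
    v ∈ threeSquares m ↔ v.1 ^ 2 + v.2.1 ^ 2 + v.2.2 ^ 2 = m := by
  simp only [threeSquares, mem_filter, mem_product, mem_Icc, and_iff_right_iff_imp]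
  intro h
  have h1 := sq_nonneg v.1
  have h2 := sq_nonneg v.2.1
  have h3 := sq_nonneg v.2.2
  exact ⟨neg_le_and_le_of_sq_le (by linarith), neg_le_and_le_of_sq_le (by linarith),
    neg_le_and_le_of_sq_le (by linarith)⟩

theorem r1_eq_card_s19 (m : ℕ) : r1 m = #(threeSquares m) := by
  exact Nat.subtype_card _ fun _ => mem_threeSquares

theorem sq_cases (x : ℤ) : (x % 2 = 1 ∧ x ^ 2 % 8 = 1) ∨ (x % 4 = 0 ∧ x ^ 2 % 8 = 0) ∨
    (x % 4 = 2 ∧ x ^ 2 % 8 = 4) := by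
  have h : x % 8 = 0 ∨ x % 8 = 1 ∨ x % 8 = 2 ∨ x % 8 = 3 ∨ x % 8 = 4 ∨ x % 8 = 5 ∨ x % 8 = 6 ∨
    x % 8 = 7 := by omega
  rcases h with h | h | h | h | h | h | h | h <;>
    rw [sq, Int.mul_emod, h] <;> norm_num <;> omega

theorem card_filter_swap_fst_snd (m : ℕ) (p : ℤ → ℤ → ℤ → Prop)
    [∀ x y z, Decidable (p x y z)] :
    #((threeSquares m).filter fun v => p v.1 v.2.1 v.2.2) =
      #((threeSquares m).filter fun v => p v.2.1 v.1 v.2.2) := by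
  refine card_nbij' (fun v => (v.2.1, v.1, v.2.2)) (fun v => (v.2.1, v.1, v.2.2))
    ?_ ?_ (fun _ _ => rfl) (fun _ _ => rfl) <;>
  · intro v hv
    simp only [coe_filter, Set.mem_ofPred_eq, mem_threeSquares] at hv ⊢
    exact ⟨by linarith [hv.1], hv.2⟩

theorem card_filter_swap_snd_thd (m : ℕ) (p : ℤ → ℤ → ℤ → Prop)
    [∀ x y z, Decidable (p x y z)] :
    #((threeSquares m).filter fun v => p v.1 v.2.1 v.2.2) =
      #((threeSquares m).filter fun v => p v.1 v.2.2 v.2.1) := by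
  refine card_nbij' (fun v => (v.1, v.2.2, v.2.1)) (fun v => (v.1, v.2.2, v.2.1))
    ?_ ?_ (fun _ _ => rfl) (fun _ _ => rfl) <;>
  · intro v hv
    simp only [coe_filter, Set.mem_ofPred_eq, mem_threeSquares] at hv ⊢
    exact ⟨by linarith [hv.1], hv.2⟩

theorem card_threeSquares {m : ℕ} (hm : m % 4 = 1) :
    #(threeSquares m) = 3 * #((threeSquares m).filter fun v => v.1 % 2 = 1) := by
  have h1 := card_filter_swap_fst_snd m fun x _ _ => x % 2 = 1
  have h2 := card_filter_swap_snd_thd m fun _ y _ => y % 2 = 1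
  have h3 : #(threeSquares m) = #((threeSquares m).filter fun v => v.1 % 2 = 1) +
      #((threeSquares m).filter fun v => v.2.1 % 2 = 1) +
      #((threeSquares m).filter fun v => v.2.2 % 2 = 1) := by
    simp only [card_filter, ← sum_add_distrib]
    rw [card_eq_sum_ones]
    refine sum_congr rfl fun v hv => ?_
    rw [mem_threeSquares] at hv
    have e1 := sq_cases v.1
    have e2 := sq_cases v.2.1
    have e3 := sq_cases v.2.2
    generalize v.1 ^ 2 = a at *
    generalize v.2.1 ^ 2 = b at *
    generalize v.2.2 ^ 2 = c at *
    split_ifs <;> omega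
  omega

theorem card_twisted_eq (m : ℕ) (hm : m % 4 = 1) :
    Nat.card {v : ℤ × ℤ × ℤ // v.1 ^ 2 + v.2.1 ^ 2 + 2 * v.2.2 ^ 2 = 2 * (m : ℤ) ∧
      v.1 ≡ 1 [ZMOD 2] ∧ v.2.1 ≡ 1 [ZMOD 2] ∧ v.2.2 ≡ 2 [ZMOD 4]} =
    #((threeSquares m).filter fun v => v.2.2 % 4 = 2) := by
  rw [← Nat.subtype_card (p := fun v : ℤ × ℤ × ℤ =>
    v.1 ^ 2 + v.2.1 ^ 2 + v.2.2 ^ 2 = m ∧ v.2.2 % 4 = 2) _ fun _ => by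
      simp only [mem_filter, mem_threeSquares]]
  refine Nat.card_congr
    { toFun := fun v => ⟨((v.1.1 + v.1.2.1) / 2, (v.1.1 - v.1.2.1) / 2, v.1.2.2), ?_⟩
      invFun := fun v => ⟨(v.1.1 + v.1.2.1, v.1.1 - v.1.2.1, v.1.2.2), ?_⟩
      left_inv := ?_
      right_inv := ?_ }
  · obtain ⟨⟨x, y, z⟩, h1, h2, h3, h4⟩ := v
    replace h1 : x ^ 2 + y ^ 2 + 2 * z ^ 2 = 2 * m := h1
    replace h2 : x % 2 = 1 := h2
    replace h3 : y % 2 = 1 := h3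
    obtain ⟨a, ha⟩ : ∃ a, x + y = 2 * a := ⟨(x + y) / 2, by omega⟩
    obtain ⟨b, hb⟩ : ∃ b, x - y = 2 * b := ⟨(x - y) / 2, by omega⟩
    refine ⟨?_, h4⟩
    dsimp only
    rw [ha, hb, Int.mul_ediv_cancel_left _ two_ne_zero, Int.mul_ediv_cancel_left _ two_ne_zero]
    obtain rfl : x = a + b := by omega
    obtain rfl : y = a - b := by omega
    linarith
  · obtain ⟨⟨a, b, z⟩, h1, h2⟩ := v
    replace h1 : a ^ 2 + b ^ 2 + z ^ 2 = m := h1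
    replace h2 : z % 4 = 2 := h2
    have e1 := sq_cases a
    have e2 := sq_cases b
    have e3 := sq_cases z
    have h3 : (a + b) % 2 = 1 := by
      generalize a ^ 2 = a' at *
      generalize b ^ 2 = b' at *
      generalize z ^ 2 = z' at *
      omega
    refine ⟨by dsimp only; linarith, h3, ?_, h2⟩
    simp only [Int.ModEq]
    omega
  · rintro ⟨⟨x, y, z⟩, h1, h2, h3, h4⟩
    replace h2 : x % 2 = 1 := h2
    replace h3 : y % 2 = 1 := h3
    refine Subtype.ext (Prod.ext ?_ (Prod.ext ?_ rfl))
    · change (x + y) / 2 + (x - y) / 2 = x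
      omega
    · change (x + y) / 2 - (x - y) / 2 = y
      omega
  · rintro ⟨⟨a, b, z⟩, h⟩
    refine Subtype.ext (Prod.ext ?_ (Prod.ext ?_ rfl))
    · change (a + b + (a - b)) / 2 = a
      omega
    · change (a + b - (a - b)) / 2 = b
      omega

theorem card_filter_thd_eq {m : ℕ} (hm : m % 4 = 1) :
    #((threeSquares m).filter fun v => v.2.2 % 4 = 2) =
      #((threeSquares m).filter fun v => v.1 % 2 = 1 ∧ v.2.2 % 4 = 2) +
        #((threeSquares m).filter fun v => v.1 % 2 = 1 ∧ v.2.2 % 4 = 2) := by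
  have h : #((threeSquares m).filter fun v => v.1 % 2 = 1 ∧ v.2.2 % 4 = 2) =
      #((threeSquares m).filter fun v => v.2.1 % 2 = 1 ∧ v.2.2 % 4 = 2) :=
    card_filter_swap_fst_snd m fun x _ z => x % 2 = 1 ∧ z % 4 = 2
  nth_rw 2 [h]
  simp only [card_filter, ← sum_add_distrib]
  refine sum_congr rfl fun v hv => ?_
  rw [mem_threeSquares] at hv
  have e1 := sq_cases v.1
  have e2 := sq_cases v.2.1
  have e3 := sq_cases v.2.2
  clear h
  generalize v.1 ^ 2 = a at *
  generalize v.2.1 ^ 2 = b at *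
  generalize v.2.2 ^ 2 = c at *
  split_ifs <;> omega

theorem card_filter_odd_of_mod_eight_eq_five {m : ℕ} (hm : m % 8 = 5) :
    #((threeSquares m).filter fun v => v.1 % 2 = 1) =
      #((threeSquares m).filter fun v => v.1 % 2 = 1 ∧ v.2.2 % 4 = 2) +
        #((threeSquares m).filter fun v => v.1 % 2 = 1 ∧ v.2.2 % 4 = 2) := by
  have h : #((threeSquares m).filter fun v => v.1 % 2 = 1 ∧ v.2.2 % 4 = 2) =
      #((threeSquares m).filter fun v => v.1 % 2 = 1 ∧ v.2.1 % 4 = 2) :=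
    card_filter_swap_snd_thd m fun x _ z => x % 2 = 1 ∧ z % 4 = 2
  nth_rw 2 [h]
  simp only [card_filter, ← sum_add_distrib]
  refine sum_congr rfl fun v hv => ?_
  rw [mem_threeSquares] at hv
  have e1 := sq_cases v.1
  have e2 := sq_cases v.2.1
  have e3 := sq_cases v.2.2
  clear h
  generalize v.1 ^ 2 = a at *
  generalize v.2.1 ^ 2 = b at *
  generalize v.2.2 ^ 2 = c at *
  split_ifs <;> omega

theorem card_filter_odd_sub_of_mod_eight_eq_one {m : ℕ} (hm : m % 8 = 1) :
    (#((threeSquares m).filter fun v => v.1 % 2 = 1) : ℤ) -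
        2 * #((threeSquares m).filter fun v => v.1 % 2 = 1 ∧ v.2.2 % 4 = 2) =
      ∑ v ∈ (threeSquares m).filter fun v => v.1 % 2 = 1, (((v.2.1 / 2).negOnePow : ℤˣ) : ℤ) := by
  simp only [card_filter, sum_filter]
  push_cast
  rw [mul_sum, ← sum_sub_distrib]
  refine sum_congr rfl fun v hv => ?_
  rw [mem_threeSquares] at hv
  have e1 := sq_cases v.1
  have e2 := sq_cases v.2.1
  have e3 := sq_cases v.2.2
  generalize v.1 ^ 2 = a at *
  generalize v.2.1 ^ 2 = b at *
  generalize v.2.2 ^ 2 = c at *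
  by_cases h1 : v.1 % 2 = 1
  · by_cases h2 : v.2.2 % 4 = 2
    · rw [Int.negOnePow_odd _ (Int.odd_iff.mpr (by omega))]
      simp [h1, h2]
    · rw [Int.negOnePow_even _ (Int.even_iff.mpr (by omega))]
      simp [h1, h2]
  · simp [h1]

theorem exists_of_mem_threeSquares {n : ℕ} {x y z : ℤ} (h : (x, y, z) ∈ threeSquares (8 * n + 1))
    (hx : x % 2 = 1) : ∃ j a b : ℤ, x = 2 * j + 1 ∧ y = 2 * (a + b) ∧ z = 2 * (a - b) := by
  rw [mem_threeSquares] at h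
  refine ⟨(x - 1) / 2, (y + z) / 4, (y - z) / 4, by omega, ?_⟩
  have e1 := sq_cases x
  have e2 := sq_cases y
  have e3 := sq_cases z
  simp only at h
  generalize x ^ 2 = a at *
  generalize y ^ 2 = b at *
  generalize z ^ 2 = c at *
  omega

theorem sum_filter_odd_eq (n : ℕ) :
    ∑ v ∈ (threeSquares (8 * n + 1)).filter fun v => v.1 % 2 = 1,
        (((v.2.1 / 2).negOnePow : ℤˣ) : ℤ) =
      ∑ a ∈ Icc (-(2 * (n + 1) : ℕ) : ℤ) (2 * (n + 1) : ℕ),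
        ∑ b ∈ Icc (-(2 * (n + 1) : ℕ) : ℤ) (2 * (n + 1) : ℕ),
          ∑ j ∈ Icc (-(2 * (n + 1) : ℕ) : ℤ) (2 * (n + 1) : ℕ),
            (if a.natAbs ^ 2 + b.natAbs ^ 2 + triangular j = n then
              (((a + b).negOnePow : ℤˣ) : ℤ) else 0) := by
  simp only [← sum_product']
  rw [← sum_filter]
  refine sum_nbij' (fun v => ((v.2.1 + v.2.2) / 4, (v.2.1 - v.2.2) / 4, (v.1 - 1) / 2))
    (fun w => (2 * w.2.2 + 1, 2 * (w.1 + w.2.1), 2 * (w.1 - w.2.1))) ?_ ?_ ?_ ?_ ?_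
  · rintro ⟨x, y, z⟩ hv
    obtain ⟨hv, hx⟩ := mem_filter.mp hv
    obtain ⟨j, a, b, rfl, rfl, rfl⟩ := exists_of_mem_threeSquares hv hx
    rw [mem_threeSquares] at hv
    have e := two_mul_triangular j
    have h : a.natAbs ^ 2 + b.natAbs ^ 2 + triangular j = n := by
      zify
      rw [sq_abs, sq_abs]
      push_cast at hv
      linarith
    have ha : a ^ 2 ≤ n := by zify at h; rw [sq_abs, sq_abs] at h; nlinarith
    have hb : b ^ 2 ≤ n := by zify at h; rw [sq_abs, sq_abs] at h; nlinarith
    have hj := abs_le.mp (abs_le_of_triangular_lt (by omega : triangular j < n + 1))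
    have ha := neg_le_and_le_of_sq_le ha
    have hb := neg_le_and_le_of_sq_le hb
    simp only [mem_filter, mem_product, mem_Icc]
    rw [show (2 * (a + b) + 2 * (a - b)) / 4 = a by omega,
      show (2 * (a + b) - 2 * (a - b)) / 4 = b by omega,
      show (2 * j + 1 - 1) / 2 = j by omega]
    refine ⟨⟨⟨?_, ?_⟩, ⟨?_, ?_⟩, ⟨?_, ?_⟩⟩, h⟩ <;> push_cast at * <;> omega
  · rintro ⟨a, b, j⟩ hw
    have h := (mem_filter.mp hw).2
    have e := two_mul_triangular j
    zify at h
    rw [sq_abs, sq_abs] at h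
    rw [mem_filter, mem_threeSquares]
    refine ⟨?_, by simp only; omega⟩
    push_cast
    linarith
  · rintro ⟨x, y, z⟩ hv
    obtain ⟨hv, hx⟩ := mem_filter.mp hv
    obtain ⟨j, a, b, rfl, rfl, rfl⟩ := exists_of_mem_threeSquares hv hx
    simp only [Prod.mk.injEq]
    omega
  · rintro ⟨a, b, j⟩ _
    simp only [Prod.mk.injEq]
    omega
  · rintro ⟨x, y, z⟩ hv
    obtain ⟨hv, hx⟩ := mem_filter.mp hv
    obtain ⟨j, a, b, rfl, rfl, rfl⟩ := exists_of_mem_threeSquares hv hx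
    simp only
    rw [show (2 * (a + b) + 2 * (a - b)) / 4 = a by omega,
      show (2 * (a + b) - 2 * (a - b)) / 4 = b by omega,
      show 2 * (a + b) / 2 = a + b by omega]

theorem stmt_19 (n : ℕ) (hn : 0 < n) :
    (Nat.card {v : ℤ × ℤ × ℤ //
        v.1 ^ 2 + v.2.1 ^ 2 + 2 * v.2.2 ^ 2 = 16 * (n : ℤ) + 2 ∧
        v.1 ≡ 1 [ZMOD 2] ∧ v.2.1 ≡ 1 [ZMOD 2] ∧ v.2.2 ≡ 2 [ZMOD 4]} : ℚ) =
      (1 / 3 : ℚ) * r1 (8 * n + 1) - 2 * sqTerm (8 * n + 1) ∧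
    (Nat.card {v : ℤ × ℤ × ℤ //
        v.1 ^ 2 + v.2.1 ^ 2 + 2 * v.2.2 ^ 2 = 16 * (n : ℤ) + 10 ∧
        v.1 ≡ 1 [ZMOD 2] ∧ v.2.1 ≡ 1 [ZMOD 2] ∧ v.2.2 ≡ 2 [ZMOD 4]} : ℚ) =
      (1 / 3 : ℚ) * r1 (8 * n + 5) := by
  have h1 := card_twisted_eq (8 * n + 1) (by omega)
  have h5 := card_twisted_eq (8 * n + 5) (by omega)
  rw [show 2 * ((8 * n + 1 : ℕ) : ℤ) = 16 * n + 2 by push_cast; ring,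
    card_filter_thd_eq (by omega)] at h1
  rw [show 2 * ((8 * n + 5 : ℕ) : ℤ) = 16 * n + 10 by push_cast; ring,
    card_filter_thd_eq (by omega), ← card_filter_odd_of_mod_eight_eq_five (by omega)] at h5
  rw [h1, h5, r1_eq_card_s19, r1_eq_card_s19, card_threeSquares (by omega), card_threeSquares (by omega)]
  refine ⟨?_, by push_cast; ring⟩
  have h2 := card_filter_odd_sub_of_mod_eight_eq_one (m := 8 * n + 1) (by omega)
  rw [sum_filter_odd_eq, coeff_theta_identity] at h2
  have h3 := congr_arg (Int.cast (R := ℚ)) h2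
  rw [Int.cast_mul, sum_triangular_eq_sqTerm] at h3
  push_cast at h3 ⊢
  linarith

end Counting
end
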